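/- Let X = [x₁,…,x_n] ∈ ℝ^{p×n}, let 2 ≤ m ≤ p, and let R₁,…,R_n ∈ ℝ^{p×m} be independent sampling matrices (each consisting of m distinct canonical basis vectors of ℝ^p chosen uniformly at random without replacement). Let ρ > 0 be such that ‖R_i R_iᵀ x_i‖₂² ≤ ρ·‖x_i‖₂² holds for every i and every realization of the sampling matrices (one may always take ρ = 1). Define Ĉ_emp = (p(p−1)/(m(m−1)))·(1/n)·Σ_{i=1}^n R_i R_iᵀ x_i x_iᵀ R_i R_iᵀ, Ĉ_n = Ĉ_emp − ((p−m)/(p−1))·diag(Ĉ_emp), and C_emp = (1/n)·Σ_{i=1}^n x_i x_iᵀ. Set L = (1/n)·[ ( (p(p−1)/(m(m−1)))·ρ + 1 )·‖X‖²_max-col + (p(p−m)/(m(m−1)))·‖X‖²_max ] and σ̄² = (1/n)·[ ( (p(p−1)/(m(m−1)))·ρ − 1 )·‖X‖²_max-col·‖C_emp‖₂ + (p(p−1)(p−m)/(m(m−1)²))·ρ·‖X‖²_max-col·‖diag(C_emp)‖₂ + (2p(p−1)(p−m)/(m(m−1)²))·‖X‖²_max·‖X‖_F²/n + (p(p−m)²/(m(m−1)²))·(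 max_{j=1,…,p} Σ_{i=1}^n X_{j,i}⁴ )/n ]. Then for all t ≥ 0: P( ‖Ĉ_n − C_emp‖₂ ≤ t ) ≥ 1 − p·exp( −(t²/2) / ( σ̄² + L·t/3 ) ). -/

import Mathlib

open Matrix Finset

/-- Probability of event `A` under the uniform distribution on the finite type `Ω`. -/
noncomputable def probOf {Ω : Type*} [Fintype Ω] (A : Set Ω) : ℝ :=
  (A.ncard : ℝ) / Fintype.card Ω

/-- Expectation of `f` under the uniform distribution on the finite type `Ω`. -/
noncomputable def expec {Ω E : Type*} [Fintype Ω] [AddCommMonoid E] [Module ℝ E]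
    (f : Ω → E) : E :=
  (Fintype.card Ω : ℝ)⁻¹ • ∑ ω, f ω

/-- Euclidean norm of a vector. -/
noncomputable def l2norm {ι : Type*} [Fintype ι] (v : ι → ℝ) : ℝ :=
  Real.sqrt (∑ i, v i ^ 2)

/-- Random sign vector `ε ∈ {±1}^p` built from boolean coin flips. -/
def signVec {p : ℕ} (ω : Fin p → Bool) : Fin p → ℝ := fun i => if ω i then 1 else -1

/-- The diagonal random sign matrix `D = diag(ε)`. -/
noncomputable def signMatrix {p : ℕ} (ω : Fin p → Bool) : Matrix (Fin p) (Fin p) ℝ :=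
  Matrix.diagonal (signVec ω)

/-- Sampling matrix `R ∈ ℝ^{p×m}` whose `j`-th column is the canonical basis vector `e_{σ j}`;
a uniformly random `σ : Fin m ↪ Fin p` models choosing `m` distinct canonical basis vectors
uniformly at random without replacement. -/
noncomputable def sampMatrix {p m : ℕ} (σ : Fin m ↪ Fin p) : Matrix (Fin p) (Fin m) ℝ :=
  Matrix.of fun i j => if σ j = i then 1 else 0

/-- Spectral norm (ℓ²→ℓ² operator norm) of a square matrix. -/
noncomputable def specNorm {p : ℕ} (A : Matrix (Fin p) (Fin p) ℝ) : ℝ :=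
  ‖LinearMap.toContinuousLinearMap (Matrix.toEuclideanLin A)‖

/-- `diag(A)`: the matrix obtained by zeroing all off-diagonal entries of `A`. -/
noncomputable def diagPart {p : ℕ} (A : Matrix (Fin p) (Fin p) ℝ) : Matrix (Fin p) (Fin p) ℝ :=
  Matrix.diagonal A.diag

/-- The rescaled empirical covariance of the subsampled data,
`Ĉ_emp = (p(p−1)/(m(m−1)))·(1/n)·Σᵢ Rᵢ Rᵢᵀ xᵢ xᵢᵀ Rᵢ Rᵢᵀ`. -/
noncomputable def covHat {p n m : ℕ} (x : Fin n → Fin p → ℝ)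
    (ω : Fin n → (Fin m ↪ Fin p)) : Matrix (Fin p) (Fin p) ℝ :=
  (((p : ℝ) * ((p : ℝ) - 1)) / ((m : ℝ) * ((m : ℝ) - 1))) •
    ((n : ℝ)⁻¹ • ∑ i,
      (sampMatrix (ω i) * (sampMatrix (ω i))ᵀ) * Matrix.vecMulVec (x i) (x i) *
        (sampMatrix (ω i) * (sampMatrix (ω i))ᵀ))

/-- The debiased covariance estimator `Ĉ_n = Ĉ_emp − ((p−m)/(p−1))·diag(Ĉ_emp)`. -/
noncomputable def covEst {p n m : ℕ} (x : Fin n → Fin p → ℝ)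
    (ω : Fin n → (Fin m ↪ Fin p)) : Matrix (Fin p) (Fin p) ℝ :=
  covHat x ω - ((((p : ℝ) - m)) / ((p : ℝ) - 1)) • diagPart (covHat x ω)

/-- The empirical covariance matrix `C_emp = (1/n)·Σᵢ xᵢ xᵢᵀ`. -/
noncomputable def covEmp {p n : ℕ} (x : Fin n → Fin p → ℝ) : Matrix (Fin p) (Fin p) ℝ :=
  (n : ℝ)⁻¹ • ∑ i, Matrix.vecMulVec (x i) (x i)

/-- The uniform bound `L` on the summands in the matrix Bernstein inequality. -/
noncomputable def bernL (p n m : ℕ) (x : Fin n → Fin p → ℝ) (ρ : ℝ) : ℝ :=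
  (n : ℝ)⁻¹ *
    (((((p : ℝ) * ((p : ℝ) - 1)) / ((m : ℝ) * ((m : ℝ) - 1))) * ρ + 1) *
        (⨆ i, ∑ j, x i j ^ 2) +
      (((p : ℝ) * ((p : ℝ) - m)) / ((m : ℝ) * ((m : ℝ) - 1))) * (⨆ j, ⨆ i, |x i j|) ^ 2)

/-- The variance bound `σ̄²` in the matrix Bernstein inequality. -/
noncomputable def bernVar (p n m : ℕ) (x : Fin n → Fin p → ℝ) (ρ : ℝ) : ℝ :=
  (n : ℝ)⁻¹ *
    (((((p : ℝ) * ((p : ℝ) - 1)) / ((m : ℝ) * ((m : ℝ) - 1))) * ρ - 1) *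
        (⨆ i, ∑ j, x i j ^ 2) * specNorm (covEmp x) +
      (((p : ℝ) * ((p : ℝ) - 1) * ((p : ℝ) - m)) / ((m : ℝ) * ((m : ℝ) - 1) ^ 2)) * ρ *
        (⨆ i, ∑ j, x i j ^ 2) * specNorm (diagPart (covEmp x)) +
      ((2 * (p : ℝ) * ((p : ℝ) - 1) * ((p : ℝ) - m)) / ((m : ℝ) * ((m : ℝ) - 1) ^ 2)) *
        (⨆ j, ⨆ i, |x i j|) ^ 2 * ((∑ i, ∑ j, x i j ^ 2) / n) +
      (((p : ℝ) * ((p : ℝ) - m) ^ 2) / ((m : ℝ) * ((m : ℝ) - 1) ^ 2)) *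
        ((⨆ j, ∑ i, x i j ^ 4) / n))

section linalg
variable {ι : Type*} [Fintype ι] [DecidableEq ι]

/-- Trace exponential of a symmetric matrix. -/
noncomputable def trE (A : Matrix ι ι ℝ) : ℝ :=
  open Classical in if h : A.IsHermitian then ∑ i, Real.exp (h.eigenvalues i) else 0

lemma trE_eq {A : Matrix ι ι ℝ} (h : A.IsHermitian) :
    trE A = ∑ i, Real.exp (h.eigenvalues i) := by
  rw [trE, dif_pos h]

lemma spec_decomp {A : Matrix ι ι ℝ} (h : A.IsHermitian) :
    ∃ U : Matrix ι ι ℝ, Uᵀ * U = 1 ∧ U * Uᵀ = 1 ∧ A = U * diagonal h.eigenvalues * Uᵀ := by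
  refine ⟨h.eigenvectorUnitary, ?_, ?_, ?_⟩
  · have := Unitary.coe_star_mul_self h.eigenvectorUnitary
    simpa [star_eq_conjTranspose] using this
  · have := Unitary.coe_mul_star_self h.eigenvectorUnitary
    simpa [star_eq_conjTranspose] using this
  · have := h.spectral_theorem
    simpa [star_eq_conjTranspose, Unitary.conjStarAlgAut_apply, Function.comp_def] using this

lemma tr_two (U V : Matrix ι ι ℝ) (b l : ι → ℝ) :
    trace (U * diagonal b * Uᵀ * (V * diagonal l * Vᵀ)) =
      ∑ i, ∑ j, (Uᵀ * V) i j ^ 2 * (b i * l j) := by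
  have : trace (U * diagonal b * Uᵀ * (V * diagonal l * Vᵀ)) =
      trace (diagonal b * (Uᵀ * V) * diagonal l * (Uᵀ * V)ᵀ) := by
    rw [transpose_mul, transpose_transpose]
    rw [show U * diagonal b * Uᵀ * (V * diagonal l * Vᵀ) =
      U * (diagonal b * (Uᵀ * V) * diagonal l * Vᵀ) by simp only [Matrix.mul_assoc]]
    rw [trace_mul_comm]
    simp only [Matrix.mul_assoc]
  rw [this, trace]
  refine Finset.sum_congr rfl fun i _ => ?_
  rw [diag_apply, Matrix.mul_apply]
  refine Finset.sum_congr rfl fun j _ => ?_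
  rw [mul_diagonal, diagonal_mul, transpose_apply]; ring

lemma q_row {U V : Matrix ι ι ℝ} (hU : Uᵀ * U = 1) (hV : V * Vᵀ = 1) (i : ι) :
    ∑ j, (Uᵀ * V) i j ^ 2 = 1 := by
  have h : ((Uᵀ * V) * (Uᵀ * V)ᵀ) = 1 := by
    rw [transpose_mul, transpose_transpose, Matrix.mul_assoc, ← Matrix.mul_assoc V, hV,
      Matrix.one_mul, hU]
  have := congrFun (congrFun h i) i
  rw [Matrix.mul_apply] at this
  simpa [sq] using this

lemma q_col {U V : Matrix ι ι ℝ} (hU : U * Uᵀ = 1) (hV : Vᵀ * V = 1) (j : ι) :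
    ∑ i, (Uᵀ * V) i j ^ 2 = 1 := by
  have := q_row hV hU j
  rw [← this]
  refine Finset.sum_congr rfl fun i _ => ?_
  rw [← transpose_apply (Uᵀ * V), transpose_mul, transpose_transpose]

lemma tr_one {U : Matrix ι ι ℝ} (hU : Uᵀ * U = 1) (b : ι → ℝ) :
    trace (U * diagonal b * Uᵀ) = ∑ i, b i := by
  rw [trace_mul_comm, ← Matrix.mul_assoc, hU, Matrix.one_mul, trace_diagonal]

lemma trX1 {U V : Matrix ι ι ℝ} (hU : Uᵀ * U = 1) (hV : Vᵀ * V = 1)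
    (b : ι → ℝ) (Y : Matrix ι ι ℝ) :
    trace ((U * Y * Vᵀ)ᵀ * (U * diagonal b * Uᵀ) * (U * Y * Vᵀ)) =
      ∑ i, ∑ j, b i * Y i j ^ 2 := by
  have : (U * Y * Vᵀ)ᵀ * (U * diagonal b * Uᵀ) * (U * Y * Vᵀ) =
      V * (Yᵀ * (Uᵀ * U) * diagonal b * (Uᵀ * U) * Y * Vᵀ) := by
    simp only [transpose_mul, transpose_transpose, Matrix.mul_assoc]
  rw [this, trace_mul_comm, hU, Matrix.mul_assoc _ Vᵀ V, hV, Matrix.mul_one, Matrix.mul_one,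
    Matrix.mul_one, trace, Finset.sum_comm]
  refine Finset.sum_congr rfl fun j _ => ?_
  rw [diag_apply, Matrix.mul_apply]
  refine Finset.sum_congr rfl fun i _ => ?_
  rw [mul_diagonal, transpose_apply]; ring

lemma trX2 {U V : Matrix ι ι ℝ} (hU : Uᵀ * U = 1) (hV : Vᵀ * V = 1)
    (a : ι → ℝ) (Y : Matrix ι ι ℝ) :
    trace ((U * Y * Vᵀ) * (V * diagonal a * Vᵀ) * (U * Y * Vᵀ)ᵀ) =
      ∑ i, ∑ j, a j * Y i j ^ 2 := by
  have : (U * Y * Vᵀ) * (V * diagonal a * Vᵀ) * (U * Y * Vᵀ)ᵀ =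
      U * (Y * (Vᵀ * V) * diagonal a * (Vᵀ * V) * Yᵀ * Uᵀ) := by
    simp only [transpose_mul, transpose_transpose, Matrix.mul_assoc]
  rw [this, trace_mul_comm, hV, Matrix.mul_assoc _ Uᵀ U, hU, Matrix.mul_one, Matrix.mul_one,
    Matrix.mul_one, trace]
  refine Finset.sum_congr rfl fun i _ => ?_
  rw [diag_apply, Matrix.mul_apply]
  refine Finset.sum_congr rfl fun j _ => ?_
  rw [mul_diagonal, transpose_apply]; ring

lemma trX3 {U V : Matrix ι ι ℝ} (hU : Uᵀ * U = 1) (hV : Vᵀ * V = 1)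
    (b a : ι → ℝ) (Y : Matrix ι ι ℝ) :
    trace ((U * Y * Vᵀ)ᵀ * (V * diagonal a * Vᵀ - U * diagonal b * Uᵀ)) =
      ∑ i, ∑ j, (a j - b i) * (Uᵀ * V) i j * Y i j := by
  have h1 : trace ((U * Y * Vᵀ)ᵀ * (V * diagonal a * Vᵀ)) =
      trace (Yᵀ * ((Uᵀ * V) * diagonal a)) := by
    have : (U * Y * Vᵀ)ᵀ * (V * diagonal a * Vᵀ) = V * (Yᵀ * ((Uᵀ * V) * diagonal a) * Vᵀ) := by
      simp only [transpose_mul, transpose_transpose, Matrix.mul_assoc]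
    rw [this, trace_mul_comm, Matrix.mul_assoc _ Vᵀ V, hV, Matrix.mul_one]
  have h2 : trace ((U * Y * Vᵀ)ᵀ * (U * diagonal b * Uᵀ)) =
      trace (Yᵀ * (diagonal b * (Uᵀ * V))) := by
    have : (U * Y * Vᵀ)ᵀ * (U * diagonal b * Uᵀ) = V * (Yᵀ * (Uᵀ * U) * diagonal b * Uᵀ) := by
      simp only [transpose_mul, transpose_transpose, Matrix.mul_assoc]
    rw [this, trace_mul_comm, hU, Matrix.mul_one]
    simp only [Matrix.mul_assoc]
  rw [Matrix.mul_sub, trace_sub, h1, h2, trace, trace, ← Finset.sum_sub_distrib, Finset.sum_comm]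
  refine Finset.sum_congr rfl fun j _ => ?_
  rw [diag_apply, diag_apply, Matrix.mul_apply, Matrix.mul_apply, ← Finset.sum_sub_distrib]
  refine Finset.sum_congr rfl fun i _ => ?_
  rw [mul_diagonal, diagonal_mul, transpose_apply]; ring

/-- The quadratic functional. -/
noncomputable def Jf (r : ℝ) (T A X : Matrix ι ι ℝ) : ℝ :=
  2 * trace (Xᵀ * (A - T)) - r * trace (X * A * Xᵀ) - (1 - r) * trace (Xᵀ * T * X)

lemma Jf_coord {U V : Matrix ι ι ℝ} (hU : Uᵀ * U = 1) (hV : Vᵀ * V = 1)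
    (b a : ι → ℝ) (r : ℝ) (Y : Matrix ι ι ℝ) :
    Jf r (U * diagonal b * Uᵀ) (V * diagonal a * Vᵀ) (U * Y * Vᵀ) =
    ∑ i, ∑ j, (2 * (a j - b i) * (Uᵀ * V) i j * Y i j
      - (r * a j + (1 - r) * b i) * Y i j ^ 2) := by
  rw [Jf, trX1 hU hV, trX2 hU hV, trX3 hU hV]
  simp only [Finset.mul_sum, ← Finset.sum_sub_distrib]
  refine Finset.sum_congr rfl fun i _ => Finset.sum_congr rfl fun j _ => ?_
  ring

noncomputable def Gf (r : ℝ) (U V : Matrix ι ι ℝ) (b a : ι → ℝ) : ℝ :=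
  ∑ i, ∑ j, (Uᵀ * V) i j ^ 2 * ((a j - b i) ^ 2 / (r * a j + (1 - r) * b i))

lemma mix_pos {a b r : ℝ} (ha : 0 < a) (hb : 0 < b) (h0 : 0 ≤ r) (h1 : r ≤ 1) :
    0 < r * a + (1 - r) * b := by
  rcases eq_or_lt_of_le h0 with h | h
  · subst h; simpa using hb
  · have := mul_nonneg (sub_nonneg.2 h1) hb.le
    have := mul_pos h ha
    linarith

lemma Jf_le {U V : Matrix ι ι ℝ} (hU : Uᵀ * U = 1) (hV : Vᵀ * V = 1)
    (hU' : U * Uᵀ = 1) (hV' : V * Vᵀ = 1)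
    {b a : ι → ℝ} (hb : ∀ i, 0 < b i) (ha : ∀ i, 0 < a i) {r : ℝ} (h0 : 0 ≤ r) (h1 : r ≤ 1)
    (X : Matrix ι ι ℝ) :
    Jf r (U * diagonal b * Uᵀ) (V * diagonal a * Vᵀ) X ≤ Gf r U V b a := by
  have hX : X = U * (Uᵀ * X * V) * Vᵀ := by
    calc X = (U * Uᵀ) * X * (V * Vᵀ) := by rw [hU', hV', Matrix.one_mul, Matrix.mul_one]
      _ = _ := by simp only [Matrix.mul_assoc]
  rw [hX, Jf_coord hU hV, Gf]
  refine Finset.sum_le_sum fun i _ => Finset.sum_le_sum fun j _ => ?_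
  have hp := mix_pos (ha j) (hb i) h0 h1
  set m := r * a j + (1 - r) * b i
  set y := (Uᵀ * X * V) i j
  set q := (Uᵀ * V) i j
  rw [mul_div_assoc', le_div_iff₀ hp]
  nlinarith [sq_nonneg (q * (a j - b i) - m * y)]

lemma Jf_eq {U V : Matrix ι ι ℝ} (hU : Uᵀ * U = 1) (hV : Vᵀ * V = 1)
    {b a : ι → ℝ} (hb : ∀ i, 0 < b i) (ha : ∀ i, 0 < a i) {r : ℝ} (h0 : 0 ≤ r) (h1 : r ≤ 1) :
    ∃ X, Jf r (U * diagonal b * Uᵀ) (V * diagonal a * Vᵀ) X = Gf r U V b a := by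
  refine ⟨U * (Matrix.of fun i j => (a j - b i) * (Uᵀ * V) i j / (r * a j + (1 - r) * b i)) * Vᵀ, ?_⟩
  rw [Jf_coord hU hV, Gf]
  refine Finset.sum_congr rfl fun i _ => Finset.sum_congr rfl fun j _ => ?_
  have hp := mix_pos (ha j) (hb i) h0 h1
  rw [of_apply]
  field_simp
  ring

noncomputable def Df (U V : Matrix ι ι ℝ) (b a : ι → ℝ) : ℝ :=
  ∑ i, ∑ j, (Uᵀ * V) i j ^ 2 *
    (b i * Real.log (b i) - b i * Real.log (a j) - b i + a j)

lemma scal_cont {a b : ℝ} (ha : 0 < a) (hb : 0 < b) :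
    ContinuousOn (fun r : ℝ => r * ((a - b) ^ 2 / (r * a + (1 - r) * b))) (Set.uIcc 0 1) := by
  rw [Set.uIcc_of_le zero_le_one]
  refine ContinuousOn.mul continuousOn_id (ContinuousOn.div continuousOn_const ?_ ?_)
  · fun_prop
  · intro r hr; exact (mix_pos ha hb hr.1 hr.2).ne'

lemma scal_int {a b : ℝ} (ha : 0 < a) (hb : 0 < b) :
    ∫ r in (0:ℝ)..1, r * ((a - b) ^ 2 / (r * a + (1 - r) * b)) =
      b * Real.log b - b * Real.log a - b + a := by
  have key := intervalIntegral.integral_eq_sub_of_hasDerivAt (a := 0) (b := 1)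
    (f := fun r : ℝ => (r * a + (1 - r) * b) - b * Real.log (r * a + (1 - r) * b))
    (f' := fun r : ℝ => r * ((a - b) ^ 2 / (r * a + (1 - r) * b))) ?_
    (scal_cont ha hb).intervalIntegrable
  · rw [key]; simp; ring
  · intro r hr
    rw [Set.uIcc_of_le zero_le_one] at hr
    have hp := mix_pos ha hb hr.1 hr.2
    have h1 : HasDerivAt (fun r : ℝ => r * a + (1 - r) * b) (a - b) r := by
      have := ((hasDerivAt_id r).mul_const a).add (((hasDerivAt_id r).const_sub 1).mul_const b)
      refine this.congr_deriv ?_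
      ring
    refine (h1.sub ((h1.log hp.ne').const_mul b)).congr_deriv ?_
    have hne := hp.ne'
    generalize hw : r * a + (1 - r) * b = w at hne ⊢
    have hw' : w = r * (a - b) + b := by rw [← hw]; ring
    field_simp
    rw [hw']; ring

lemma Df_int (U V : Matrix ι ι ℝ) {b a : ι → ℝ} (hb : ∀ i, 0 < b i) (ha : ∀ i, 0 < a i) :
    IntervalIntegrable (fun r => r * Gf r U V b a) MeasureTheory.volume 0 1 ∧
    ∫ r in (0:ℝ)..1, r * Gf r U V b a = Df U V b a := by
  have e : (fun r => r * Gf r U V b a) = fun r => ∑ i, ∑ j, (Uᵀ * V) i j ^ 2 *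
      (r * ((a j - b i) ^ 2 / (r * a j + (1 - r) * b i))) := by
    funext r
    rw [Gf, Finset.mul_sum]
    refine Finset.sum_congr rfl fun i _ => ?_
    rw [Finset.mul_sum]
    refine Finset.sum_congr rfl fun j _ => ?_
    ring
  have hC : ∀ i j, ContinuousOn (fun r => (Uᵀ * V) i j ^ 2 *
      (r * ((a j - b i) ^ 2 / (r * a j + (1 - r) * b i)))) (Set.uIcc 0 1) := fun i j =>
    continuousOn_const.mul (scal_cont (ha j) (hb i))
  have hI : ∀ i j, IntervalIntegrable (fun r => (Uᵀ * V) i j ^ 2 *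
      (r * ((a j - b i) ^ 2 / (r * a j + (1 - r) * b i)))) MeasureTheory.volume 0 1 := fun i j =>
    (hC i j).intervalIntegrable
  have hC2 : ∀ i, ContinuousOn (fun r => ∑ j, (Uᵀ * V) i j ^ 2 *
      (r * ((a j - b i) ^ 2 / (r * a j + (1 - r) * b i)))) (Set.uIcc 0 1) := fun i =>
    continuousOn_finsetSum _ fun j _ => hC i j
  have hI2 := fun i => (hC2 i).intervalIntegrable (μ := MeasureTheory.volume)
  rw [e]
  constructor
  · exact (continuousOn_finsetSum _ fun i _ => hC2 i).intervalIntegrable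
  · rw [intervalIntegral.integral_finsetSum (fun i _ => hI2 i), Df]
    refine Finset.sum_congr rfl fun i _ => ?_
    rw [intervalIntegral.integral_finsetSum (fun j _ => hI i j)]
    refine Finset.sum_congr rfl fun j _ => ?_
    rw [intervalIntegral.integral_const_mul, scal_int (ha j) (hb i)]

end linalg

section lieb
variable {ι : Type*} [Fintype ι] [DecidableEq ι]

lemma Jf_sum {Ω : Type*} [Fintype Ω] (r : ℝ) (T A : Ω → Matrix ι ι ℝ) (N : ℝ)
    (T' A' X : Matrix ι ι ℝ) (hT : N • T' = ∑ ω, T ω) (hA : N • A' = ∑ ω, A ω) :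
    N * Jf r T' A' X = ∑ ω, Jf r (T ω) (A ω) X := by
  have h1 : N * trace (Xᵀ * (A' - T')) = ∑ ω, trace (Xᵀ * (A ω - T ω)) := by
    rw [← trace_sum, ← Finset.mul_sum, Finset.sum_sub_distrib, ← hT, ← hA, ← smul_sub,
      Matrix.mul_smul, trace_smul, smul_eq_mul]
  have h2 : N * trace (X * A' * Xᵀ) = ∑ ω, trace (X * A ω * Xᵀ) := by
    rw [← trace_sum, ← Finset.sum_mul, ← Finset.mul_sum, ← hA,
      Matrix.mul_smul, Matrix.smul_mul, trace_smul, smul_eq_mul]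
  have h3 : N * trace (Xᵀ * T' * X) = ∑ ω, trace (Xᵀ * T ω * X) := by
    rw [← trace_sum, ← Finset.sum_mul, ← Finset.mul_sum, ← hT,
      Matrix.mul_smul, Matrix.smul_mul, trace_smul, smul_eq_mul]
  simp only [Jf, Finset.sum_sub_distrib, ← Finset.mul_sum, ← h1, ← h2, ← h3]
  ring

lemma Df_conv {Ω : Type*} [Fintype Ω] (U V : Ω → Matrix ι ι ℝ) (b a : Ω → ι → ℝ)
    (hU : ∀ ω, (U ω)ᵀ * U ω = 1) (hV : ∀ ω, (V ω)ᵀ * V ω = 1)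
    (hU' : ∀ ω, U ω * (U ω)ᵀ = 1) (hV' : ∀ ω, V ω * (V ω)ᵀ = 1)
    (hb : ∀ ω i, 0 < b ω i) (ha : ∀ ω i, 0 < a ω i)
    (U0 V0 : Matrix ι ι ℝ) (b0 a0 : ι → ℝ) (hU0 : U0ᵀ * U0 = 1) (hV0 : V0ᵀ * V0 = 1)
    (hb0 : ∀ i, 0 < b0 i) (ha0 : ∀ i, 0 < a0 i) (N : ℝ)
    (hT : N • (U0 * diagonal b0 * U0ᵀ) = ∑ ω, U ω * diagonal (b ω) * (U ω)ᵀ)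
    (hA : N • (V0 * diagonal a0 * V0ᵀ) = ∑ ω, V ω * diagonal (a ω) * (V ω)ᵀ) :
    N * Df U0 V0 b0 a0 ≤ ∑ ω, Df (U ω) (V ω) (b ω) (a ω) := by
  have h0 := Df_int U0 V0 hb0 ha0
  have h := fun ω => Df_int (U ω) (V ω) (hb ω) (ha ω)
  have hpt : ∀ r ∈ Set.Icc (0:ℝ) 1, N * (r * Gf r U0 V0 b0 a0) ≤
      ∑ ω, r * Gf r (U ω) (V ω) (b ω) (a ω) := by
    intro r hr
    obtain ⟨X, hX⟩ := Jf_eq hU0 hV0 hb0 ha0 hr.1 hr.2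
    rw [← hX, ← Finset.mul_sum]
    have := Jf_sum r _ _ N _ _ X hT hA
    rw [mul_left_comm, this]
    refine mul_le_mul_of_nonneg_left (Finset.sum_le_sum fun ω _ => ?_) hr.1
    exact Jf_le (hU ω) (hV ω) (hU' ω) (hV' ω) (hb ω) (ha ω) hr.1 hr.2 X
  have hI : IntervalIntegrable (fun r => ∑ ω, r * Gf r (U ω) (V ω) (b ω) (a ω))
      MeasureTheory.volume 0 1 := by
    have := IntervalIntegrable.sum (μ := MeasureTheory.volume) (a := 0) (b := 1) Finset.univ
      (f := fun ω r => r * Gf r (U ω) (V ω) (b ω) (a ω)) (fun ω _ => (h ω).1)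
    rwa [Finset.sum_fn] at this
  have := intervalIntegral.integral_mono_on zero_le_one (h0.1.const_mul N) hI hpt
  rw [intervalIntegral.integral_const_mul, h0.2,
    intervalIntegral.integral_finsetSum (fun ω _ => (h ω).1)] at this
  refine this.trans_eq (Finset.sum_congr rfl fun ω _ => (h ω).2)

lemma Df_eq {U V : Matrix ι ι ℝ} (hU : Uᵀ * U = 1) (hV : Vᵀ * V = 1)
    (hU' : U * Uᵀ = 1) (hV' : V * Vᵀ = 1) (b a : ι → ℝ) :
    Df U V b a = ∑ i, b i * Real.log (b i)
      - trace (U * diagonal b * Uᵀ * (V * diagonal (fun j => Real.log (a j)) * Vᵀ))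
      - trace (U * diagonal b * Uᵀ) + trace (V * diagonal a * Vᵀ) := by
  have h1 : ∀ f : ι → ℝ, ∑ i, ∑ j, (Uᵀ * V) i j ^ 2 * f i = ∑ i, f i := fun f => by
    refine Finset.sum_congr rfl fun i _ => ?_
    rw [← Finset.sum_mul, q_row hU hV', one_mul]
  have h2 : ∀ f : ι → ℝ, ∑ i, ∑ j, (Uᵀ * V) i j ^ 2 * f j = ∑ i, f i := fun f => by
    rw [Finset.sum_comm]
    refine Finset.sum_congr rfl fun j _ => ?_
    rw [← Finset.sum_mul, q_col hU' hV, one_mul]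
  rw [tr_two, tr_one hU, tr_one hV, ← h1 b, ← h2 a, ← h1 (fun i => b i * Real.log (b i)), Df]
  simp only [mul_add, mul_sub, Finset.sum_add_distrib, Finset.sum_sub_distrib]

lemma tr_two_nonneg (U V : Matrix ι ι ℝ) (b l : ι → ℝ) (hb : ∀ i, 0 ≤ b i) (hl : ∀ i, 0 ≤ l i) :
    0 ≤ trace (U * diagonal b * Uᵀ * (V * diagonal l * Vᵀ)) := by
  rw [tr_two]
  exact Finset.sum_nonneg fun i _ => Finset.sum_nonneg fun j _ =>
    mul_nonneg (sq_nonneg _) (mul_nonneg (hb i) (hl j))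

lemma posDef_decomp {U : Matrix ι ι ℝ} (hU : U * Uᵀ = 1) (b : ι → ℝ) (hb : ∀ i, 0 < b i) :
    (U * diagonal b * Uᵀ).PosDef := by
  have hd : (diagonal b).PosDef := PosDef.diagonal hb
  have hinj : Function.Injective (U.vecMul) := by
    intro v w h
    have : (v ᵥ* U) ᵥ* Uᵀ = (w ᵥ* U) ᵥ* Uᵀ := by
      simp only at h; rw [h]
    simpa [vecMul_vecMul, hU] using this
  have := hd.mul_mul_conjTranspose_same hinj
  simpa using this

lemma gibbs {U : Matrix ι ι ℝ} (hU : Uᵀ * U = 1) (hU' : U * Uᵀ = 1) {b : ι → ℝ}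
    (hb : ∀ i, 0 < b i) {K : Matrix ι ι ℝ} (hK : K.IsHermitian) :
    trace (U * diagonal b * Uᵀ * K) - ∑ i, b i * Real.log (b i) + trace (U * diagonal b * Uᵀ)
      ≤ trE K := by
  obtain ⟨V, hV, hV', e⟩ := spec_decomp hK
  have h := Df_eq hU hV hU' hV' b (fun i => Real.exp (hK.eigenvalues i))
  simp only [Real.log_exp] at h
  rw [← e, tr_one hV, ← trE_eq hK] at h
  have : 0 ≤ Df U V b (fun i => Real.exp (hK.eigenvalues i)) := by
    refine Finset.sum_nonneg fun i _ => Finset.sum_nonneg fun j _ =>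
      mul_nonneg (sq_nonneg _) ?_
    rw [Real.log_exp]
    set l := hK.eigenvalues j
    have h1 := Real.add_one_le_exp (l - Real.log (b i))
    rw [Real.exp_sub, Real.exp_log (hb i), le_div_iff₀ (hb i)] at h1
    linarith
  linarith

lemma lieb_step {Ω : Type*} [Fintype Ω] [Nonempty Ω] (H : Matrix ι ι ℝ) (hH : H.IsHermitian)
    (Z : Ω → Matrix ι ι ℝ) (hZ : ∀ ω, (Z ω).IsHermitian) (g : ℝ)
    (hexp : ∀ ω i, Real.exp ((hZ ω).eigenvalues i) ≤
      1 + (hZ ω).eigenvalues i + g * (hZ ω).eigenvalues i ^ 2)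
    (hmean : ∑ ω, Z ω = 0) (W : Matrix ι ι ℝ) (hWh : W.IsHermitian)
    (hW : (Fintype.card Ω : ℝ) • W = g • ∑ ω, Z ω * Z ω) :
    ∑ ω, trE (H + Z ω) ≤ (Fintype.card Ω : ℝ) * trE (H + W) := by
  have hK : ∀ ω, (H + Z ω).IsHermitian := fun ω => hH.add (hZ ω)
  choose U hU hU' eU using fun ω => spec_decomp (hK ω)
  choose V hV hV' eV using fun ω => spec_decomp (hZ ω)
  set k := fun ω => (hK ω).eigenvalues with hk
  set z := fun ω => (hZ ω).eigenvalues with hz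
  set T := fun ω => U ω * diagonal (fun i => Real.exp (k ω i)) * (U ω)ᵀ with hTdef
  set A := fun ω => V ω * diagonal (fun i => Real.exp (z ω i)) * (V ω)ᵀ with hAdef
  have hTp : ∀ ω, (T ω).PosDef := fun ω => posDef_decomp (hU' ω) _ fun i => Real.exp_pos _
  have hAp : ∀ ω, (A ω).PosDef := fun ω => posDef_decomp (hV' ω) _ fun i => Real.exp_pos _
  set N : ℝ := (Fintype.card Ω : ℝ) with hN
  have hNpos : 0 < N := by rw [hN]; exact_mod_cast Fintype.card_pos
  set T0 := N⁻¹ • ∑ ω, T ω with hT0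
  set A0 := N⁻¹ • ∑ ω, A ω with hA0
  have hT0p : T0.PosDef := (posDef_sum Finset.univ_nonempty fun ω _ => hTp ω).smul (inv_pos.2 hNpos)
  have hA0p : A0.PosDef := (posDef_sum Finset.univ_nonempty fun ω _ => hAp ω).smul (inv_pos.2 hNpos)
  have hNT : N • T0 = ∑ ω, T ω := by rw [hT0, smul_smul, mul_inv_cancel₀ hNpos.ne', one_smul]
  have hNA : N • A0 = ∑ ω, A ω := by rw [hA0, smul_smul, mul_inv_cancel₀ hNpos.ne', one_smul]
  clear_value T0 A0
  obtain ⟨U0, hU0, hU0', eU0⟩ := spec_decomp hT0p.1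
  obtain ⟨V0, hV0, hV0', eV0⟩ := spec_decomp hA0p.1
  have hb0 := hT0p.eigenvalues_pos
  have ha0 := hA0p.eigenvalues_pos
  set b := hT0p.1.eigenvalues with hb
  set a := hA0p.1.eigenvalues with ha
  have conv := Df_conv U V (fun ω i => Real.exp (k ω i)) (fun ω i => Real.exp (z ω i))
    hU hV hU' hV' (fun ω i => Real.exp_pos _) (fun ω i => Real.exp_pos _) U0 V0 b a hU0 hV0
    hb0 ha0 N (by rw [← eU0, hNT]) (by rw [← eV0, hNA])
  have hD : ∀ ω, Df (U ω) (V ω) (fun i => Real.exp (k ω i)) (fun i => Real.exp (z ω i)) =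
      trace (T ω * H) - trace (T ω) + trace (A ω) := by
    intro ω
    rw [Df_eq (hU ω) (hV ω) (hU' ω) (hV' ω)]
    simp only [Real.log_exp]
    have e1 : ∑ i, Real.exp (k ω i) * k ω i = trace (T ω * (H + Z ω)) := by
      conv_rhs => rw [eU ω]
      rw [hTdef]
      simp only []
      rw [show U ω * diagonal (fun i => Real.exp (k ω i)) * (U ω)ᵀ *
        (U ω * diagonal (hK ω).eigenvalues * (U ω)ᵀ) = U ω * diagonal (fun i => Real.exp (k ω i)) *
        ((U ω)ᵀ * U ω) * diagonal (hK ω).eigenvalues * (U ω)ᵀ by simp only [Matrix.mul_assoc],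
        hU ω, Matrix.mul_one, Matrix.mul_assoc (U ω), diagonal_mul_diagonal, tr_one (hU ω)]
    have e2 : V ω * diagonal (fun j => z ω j) * (V ω)ᵀ = Z ω := (eV ω).symm
    rw [e1, e2, Matrix.mul_add, trace_add]
    ring
  simp only [hD, Finset.sum_add_distrib, Finset.sum_sub_distrib, ← trace_sum, ← Finset.sum_mul,
    ← hNT, ← hNA] at conv
  rw [Matrix.smul_mul, trace_smul, trace_smul, trace_smul, smul_eq_mul, smul_eq_mul, smul_eq_mul,
    ← mul_sub, ← mul_add] at conv
  have conv2 := le_of_mul_le_mul_left conv hNpos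
  rw [Df_eq hU0 hV0 hU0' hV0', ← eU0, ← eV0] at conv2
  -- log a ≤ a - 1
  have l1 : trace (T0 * (V0 * diagonal (fun j => Real.log (a j)) * V0ᵀ)) ≤
      trace (T0 * A0) - trace T0 := by
    have h := tr_two_nonneg U0 V0 b (fun j => a j - 1 - Real.log (a j)) (fun i => (hb0 i).le)
      (fun i => by have := Real.log_le_sub_one_of_pos (ha0 i); linarith)
    rw [← eU0] at h
    have : V0 * diagonal (fun j => a j - 1 - Real.log (a j)) * V0ᵀ =
        A0 - 1 - V0 * diagonal (fun j => Real.log (a j)) * V0ᵀ := by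
      have e : diagonal (fun j => a j - 1 - Real.log (a j)) =
        diagonal a - 1 - diagonal (fun j => Real.log (a j)) := by
        rw [← diagonal_one, diagonal_sub, diagonal_sub]
      rw [e, Matrix.mul_sub, Matrix.mul_sub, Matrix.sub_mul, Matrix.sub_mul, ← eV0,
        Matrix.mul_one, hV0']
    rw [this, Matrix.mul_sub, Matrix.mul_sub, trace_sub, trace_sub, Matrix.mul_one] at h
    linarith
  have l2 : trace (T0 * A0) ≤ trace T0 + trace (T0 * W) := by
    have h : ∀ ω, trace (T0 * A ω) ≤ trace T0 + trace (T0 * Z ω) + g * trace (T0 * (Z ω * Z ω)) := by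
      intro ω
      have h := tr_two_nonneg U0 (V ω) b (fun j => 1 + z ω j + g * z ω j ^ 2 - Real.exp (z ω j))
        (fun i => (hb0 i).le) (fun i => by have := hexp ω i; simp only [hz]; linarith)
      rw [← eU0] at h
      have : V ω * diagonal (fun j => 1 + z ω j + g * z ω j ^ 2 - Real.exp (z ω j)) * (V ω)ᵀ =
          1 + Z ω + g • (Z ω * Z ω) - A ω := by
        have e : diagonal (fun j => 1 + z ω j + g * z ω j ^ 2 - Real.exp (z ω j)) =
          1 + diagonal (z ω) + g • (diagonal (z ω) * diagonal (z ω))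
            - diagonal (fun j => Real.exp (z ω j)) := by
          rw [← diagonal_one, diagonal_mul_diagonal, ← diagonal_smul, diagonal_add, diagonal_add,
            diagonal_sub]
          congr 1; funext j; simp [sq]
        have e3 : Z ω * Z ω = V ω * (diagonal (z ω) * diagonal (z ω)) * (V ω)ᵀ := by
          conv_lhs => rw [eV ω]
          rw [show V ω * diagonal (hZ ω).eigenvalues * (V ω)ᵀ *
            (V ω * diagonal (hZ ω).eigenvalues * (V ω)ᵀ) = V ω * diagonal (hZ ω).eigenvalues *
            ((V ω)ᵀ * V ω) * diagonal (hZ ω).eigenvalues * (V ω)ᵀ by simp only [Matrix.mul_assoc],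
            hV ω, Matrix.mul_one, Matrix.mul_assoc (V ω)]
        have e4 : V ω * diagonal (z ω) * (V ω)ᵀ = Z ω := (eV ω).symm
        rw [e, Matrix.mul_sub, Matrix.mul_add, Matrix.mul_add, Matrix.sub_mul, Matrix.add_mul,
          Matrix.add_mul, Matrix.mul_one, hV', Matrix.mul_smul, Matrix.smul_mul, e3, e4]
      rw [this, Matrix.mul_sub, Matrix.mul_add, Matrix.mul_add, trace_sub, trace_add, trace_add,
        Matrix.mul_one, Matrix.mul_smul, trace_smul, smul_eq_mul] at h
      linarith
    have hs := Finset.sum_le_sum (s := Finset.univ) fun ω _ => h ω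
    rw [Finset.sum_add_distrib, Finset.sum_add_distrib, ← Finset.mul_sum] at hs
    simp only [← trace_sum, ← Finset.mul_sum] at hs
    rw [hmean, ← hNA, Matrix.mul_zero, trace_zero, Matrix.mul_smul, trace_smul, smul_eq_mul,
      Finset.sum_const, Finset.card_univ, trace_smul, nsmul_eq_mul, ← smul_eq_mul g, ← trace_smul,
      ← Matrix.mul_smul, ← hW, Matrix.mul_smul, trace_smul, smul_eq_mul] at hs
    refine le_of_mul_le_mul_left ?_ hNpos
    linarith
  have gb := gibbs hU0 hU0' hb0 (hH.add hWh)
  rw [← eU0, Matrix.mul_add, trace_add] at gb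
  have fin : trace T0 ≤ trE (H + W) := by linarith
  have hsum : ∑ ω, trE (H + Z ω) = N * trace T0 := by
    rw [← smul_eq_mul, ← trace_smul, hNT, trace_sum]
    refine Finset.sum_congr rfl fun ω _ => ?_
    rw [trE_eq (hK ω), hTdef]
    simp only []
    rw [tr_one (hU ω)]
  rw [hsum]
  exact mul_le_mul_of_nonneg_left fin hNpos.le

lemma lieb_sum {Ω : Type*} [Fintype Ω] [Nonempty Ω] (g : ℝ) (n : ℕ) :
    ∀ (Z : Fin n → Ω → Matrix ι ι ℝ) (hZ : ∀ i ω, (Z i ω).IsHermitian)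
    (_ : ∀ i ω j, Real.exp ((hZ i ω).eigenvalues j) ≤
      1 + (hZ i ω).eigenvalues j + g * (hZ i ω).eigenvalues j ^ 2)
    (_ : ∀ i, ∑ ω, Z i ω = 0) (W : Fin n → Matrix ι ι ℝ) (_ : ∀ i, (W i).IsHermitian)
    (_ : ∀ i, (Fintype.card Ω : ℝ) • W i = g • ∑ ω, Z i ω * Z i ω)
    (H : Matrix ι ι ℝ) (_ : H.IsHermitian),
    ∑ ω : Fin n → Ω, trE (H + ∑ i, Z i (ω i)) ≤ (Fintype.card Ω : ℝ) ^ n * trE (H + ∑ i, W i) := by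
  induction n with
  | zero =>
    intro Z hZ _ _ W _ _ H hH
    simp
  | succ n ih =>
    intro Z hZ hexp hmean W hWh hW H hH
    rw [← (Fin.consEquiv (fun _ => Ω)).sum_comp, Fintype.sum_prod_type]
    have hsumW : (∑ i : Fin n, W i.succ).IsHermitian := by
      unfold Matrix.IsHermitian
      rw [conjTranspose_sum]
      exact Finset.sum_congr rfl fun i _ => hWh _
    have h1 : ∀ a : Ω, ∑ ω : Fin n → Ω, trE (H + ∑ i, Z i ((Fin.consEquiv (fun _ => Ω)) (a, ω) i)) ≤
        (Fintype.card Ω : ℝ) ^ n * trE ((H + ∑ i : Fin n, W i.succ) + Z 0 a) := by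
      intro a
      have := ih (fun i => Z i.succ) (fun i => hZ i.succ) (fun i => hexp i.succ)
        (fun i => hmean i.succ) (fun i => W i.succ) (fun i => hWh i.succ) (fun i => hW i.succ)
        (H + Z 0 a) (hH.add (hZ 0 a))
      rw [show H + ∑ i : Fin n, W i.succ + Z 0 a = H + Z 0 a + ∑ i : Fin n, W i.succ by abel]
      refine le_trans (le_of_eq ?_) this
      refine Finset.sum_congr rfl fun ω _ => ?_
      rw [Fin.sum_univ_succ, ← add_assoc]
      simp [Fin.consEquiv]
    refine (Finset.sum_le_sum fun a _ => h1 a).trans ?_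
    rw [← Finset.mul_sum]
    have := lieb_step (H + ∑ i : Fin n, W i.succ) (hH.add hsumW) (Z 0) (hZ 0) g (hexp 0) (hmean 0)
      (W 0) (hWh 0) (hW 0)
    refine (mul_le_mul_of_nonneg_left this (by positivity)).trans (le_of_eq ?_)
    rw [Fin.sum_univ_succ, pow_succ,
      show H + ∑ i : Fin n, W i.succ + W 0 = H + (W 0 + ∑ i : Fin n, W i.succ) by abel]
    ring

end lieb

lemma exp_pade {z : ℝ} (h0 : 0 ≤ z) (h3 : z < 3) :
    Real.exp z ≤ 1 + z + (1 / 2 / (1 - z / 3)) * z ^ 2 := by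
  have hmono : MonotoneOn (fun x : ℝ => (6 + 4 * x + x ^ 2) / (6 - 2 * x) * Real.exp (-x))
      (Set.Ico 0 3) := by
    have hd : ∀ x ∈ Set.Ico (0:ℝ) 3, HasDerivAt
        (fun x : ℝ => (6 + 4 * x + x ^ 2) / (6 - 2 * x) * Real.exp (-x))
        (2 * x ^ 3 / (6 - 2 * x) ^ 2 * Real.exp (-x)) x := by
      intro x hx
      have hne : (6 - 2 * x) ≠ 0 := by have := hx.2; linarith
      have h1 : HasDerivAt (fun x : ℝ => 6 + 4 * x + x ^ 2) (4 + 2 * x) x := by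
        have := (((hasDerivAt_id x).const_mul 4).const_add 6).add (hasDerivAt_pow 2 x)
        refine this.congr_deriv ?_
        simp
      have h2 : HasDerivAt (fun x : ℝ => 6 - 2 * x) (-2) x := by
        have := ((hasDerivAt_id x).const_mul 2).const_sub 6
        refine this.congr_deriv ?_
        simp
      have h3 : HasDerivAt (fun x : ℝ => Real.exp (-x)) (-Real.exp (-x)) x := by
        have := (hasDerivAt_id x).neg.exp
        refine this.congr_deriv ?_
        simp
      refine ((h1.div h2 hne).mul h3).congr_deriv ?_
      simp only [Pi.div_apply]
      field_simp
      ring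
    refine monotoneOn_of_deriv_nonneg (convex_Ico 0 3)
      (fun x hx => (hd x hx).continuousAt.continuousWithinAt)
      (fun x hx => (hd x (interior_subset hx)).differentiableAt.differentiableWithinAt) ?_
    intro x hx
    have hx' := interior_subset hx
    rw [(hd x hx').deriv]
    have := hx'.1
    positivity
  have := hmono (Set.left_mem_Ico.2 (by norm_num)) ⟨h0, h3⟩ h0
  simp only [] at this
  norm_num at this
  rw [Real.exp_neg, ← div_eq_mul_inv, one_le_div (Real.exp_pos z)] at this
  refine this.trans (le_of_eq ?_)
  have h1 : 6 - 2 * z ≠ 0 := by linarith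
  have h2 : 1 - z / 3 ≠ 0 := by linarith
  have h4 : 3 - z ≠ 0 := by linarith
  rw [show 6 - 2 * z = 2 * (3 - z) by ring, show 1 - z / 3 = (3 - z) / 3 by ring]
  field_simp
  ring

lemma exp_neg_quad {z : ℝ} (h0 : z ≤ 0) : Real.exp z ≤ 1 + z + 1 / 2 * z ^ 2 := by
  have h : 0 ≤ -z := by linarith
  have h1 := Real.quadratic_le_exp_of_nonneg h
  have hanti : AntitoneOn (fun x : ℝ => 1 + x + 1 / 2 * x ^ 2 - Real.exp x) (Set.Iic 0) := by
    have hd : ∀ x : ℝ, HasDerivAt (fun x : ℝ => 1 + x + 1 / 2 * x ^ 2 - Real.exp x)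
        (1 + x - Real.exp x) x := by
      intro x
      have := ((((hasDerivAt_id x).const_add 1).add
        ((hasDerivAt_pow 2 x).const_mul (1 / 2)))).sub (Real.hasDerivAt_exp x)
      refine this.congr_deriv ?_
      simp
    refine antitoneOn_of_deriv_nonpos (convex_Iic 0)
      (fun x hx => (hd x).continuousAt.continuousWithinAt)
      (fun x hx => (hd x).differentiableAt.differentiableWithinAt) ?_
    intro x hx
    rw [(hd x).deriv]
    have := Real.add_one_le_exp x
    linarith
  have := hanti (Set.mem_Iic.2 h0) (Set.mem_Iic.2 le_rfl) h0
  simp at this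
  linarith

lemma exp_bern {z c : ℝ} (hz : z ≤ c) (hc : 0 ≤ c) (hc3 : c < 3) :
    Real.exp z ≤ 1 + z + (1 / 2 / (1 - c / 3)) * z ^ 2 := by
  have hpos : 0 < 1 - c / 3 := by linarith
  rcases le_total z 0 with h | h
  · refine (exp_neg_quad h).trans ?_
    have : (1:ℝ) / 2 ≤ 1 / 2 / (1 - c / 3) := by
      rw [le_div_iff₀ hpos]; linarith
    nlinarith [sq_nonneg z]
  · refine (exp_pade h (by linarith)).trans ?_
    have : (1:ℝ) / 2 / (1 - z / 3) ≤ 1 / 2 / (1 - c / 3) := by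
      apply div_le_div_of_nonneg_left (by norm_num) hpos
      linarith
    nlinarith [sq_nonneg z]

section C
variable {ι : Type*} [Fintype ι] [DecidableEq ι]

lemma quad_spec {A : Matrix ι ι ℝ} (h : A.IsHermitian) :
    ∃ U : Matrix ι ι ℝ, (∀ w, w ⬝ᵥ (A *ᵥ w) = ∑ j, h.eigenvalues j * (Uᵀ *ᵥ w) j ^ 2) ∧
      (∀ w, w ⬝ᵥ w = ∑ j, (Uᵀ *ᵥ w) j ^ 2) ∧
      (∀ w, (A *ᵥ w) ⬝ᵥ (A *ᵥ w) = ∑ j, h.eigenvalues j ^ 2 * (Uᵀ *ᵥ w) j ^ 2) ∧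
      (∀ j, ∃ w, w ⬝ᵥ w = 1 ∧ w ⬝ᵥ (A *ᵥ w) = h.eigenvalues j) := by
  obtain ⟨U, h1, h2, e⟩ := spec_decomp h
  set l := h.eigenvalues
  have gen : ∀ d : ι → ℝ, ∀ w, w ⬝ᵥ ((U * diagonal d * Uᵀ) *ᵥ w) = ∑ j, d j * (Uᵀ *ᵥ w) j ^ 2 := by
    intro d w
    rw [Matrix.mul_assoc, ← mulVec_mulVec, ← mulVec_mulVec, dotProduct_mulVec, ← mulVec_transpose,
      dotProduct]
    refine Finset.sum_congr rfl fun j _ => ?_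
    rw [mulVec_diagonal]; ring
  have q1 : ∀ w, w ⬝ᵥ (A *ᵥ w) = ∑ j, l j * (Uᵀ *ᵥ w) j ^ 2 := fun w => by
    conv_lhs => rw [e]
    exact gen l w
  have q2 : ∀ w, w ⬝ᵥ w = ∑ j, (Uᵀ *ᵥ w) j ^ 2 := fun w => by
    have := gen 1 w
    rw [show diagonal (1 : ι → ℝ) = 1 from diagonal_one, Matrix.mul_one, h2, one_mulVec] at this
    simpa using this
  refine ⟨U, q1, q2, ?_, ?_⟩
  · intro w
    have hA2 : A * A = U * diagonal (fun j => l j ^ 2) * Uᵀ := by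
      conv_lhs => rw [e]
      rw [show U * diagonal l * Uᵀ * (U * diagonal l * Uᵀ) = U * diagonal l *
        (Uᵀ * U) * diagonal l * Uᵀ by simp only [Matrix.mul_assoc], h1, Matrix.mul_one,
        Matrix.mul_assoc U, diagonal_mul_diagonal]
      simp only [sq]
    have hT : Aᵀ = A := by
      have := h.eq
      rwa [conjTranspose_eq_transpose_of_trivial] at this
    rw [← gen, ← hA2, ← mulVec_mulVec, dotProduct_mulVec w, ← mulVec_transpose, hT]
  · intro j
    refine ⟨U *ᵥ Pi.single j 1, ?_, ?_⟩
    · rw [q2, mulVec_mulVec, h1, one_mulVec]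
      rw [Finset.sum_eq_single j] <;> simp +contextual [Pi.single_apply]
    · rw [q1, mulVec_mulVec, h1, one_mulVec]
      rw [Finset.sum_eq_single j] <;> simp +contextual [Pi.single_apply]

lemma eig_le {A : Matrix ι ι ℝ} (h : A.IsHermitian) {L : ℝ}
    (hL : ∀ w, w ⬝ᵥ (A *ᵥ w) ≤ L * (w ⬝ᵥ w)) (j : ι) : h.eigenvalues j ≤ L := by
  obtain ⟨U, _, _, _, h4⟩ := quad_spec h
  obtain ⟨w, h1, h2⟩ := h4 j
  have := hL w
  rw [h1, h2] at this; linarith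

lemma eig_ge {A : Matrix ι ι ℝ} (h : A.IsHermitian) {L : ℝ}
    (hL : ∀ w, L * (w ⬝ᵥ w) ≤ w ⬝ᵥ (A *ᵥ w)) (j : ι) : L ≤ h.eigenvalues j := by
  obtain ⟨U, _, _, _, h4⟩ := quad_spec h
  obtain ⟨w, h1, h2⟩ := h4 j
  have := hL w
  rw [h1, h2] at this; linarith

lemma trE_nonneg (A : Matrix ι ι ℝ) : 0 ≤ trE A := by
  unfold trE
  split_ifs
  · exact Finset.sum_nonneg fun i _ => (Real.exp_pos _).le
  · exact le_rfl

lemma trE_ge {A : Matrix ι ι ℝ} (h : A.IsHermitian) {t : ℝ} {w : ι → ℝ}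
    (hw : t * (w ⬝ᵥ w) < w ⬝ᵥ (A *ᵥ w)) : Real.exp t ≤ trE A := by
  obtain ⟨U, h1, h2, _, _⟩ := quad_spec h
  rw [h1, h2, Finset.mul_sum] at hw
  obtain ⟨j, _, hj⟩ := Finset.exists_lt_of_sum_lt hw
  have hj' : t ≤ h.eigenvalues j := by
    by_contra hcon
    push Not at hcon
    nlinarith [sq_nonneg ((Uᵀ *ᵥ w) j)]
  rw [trE_eq h]
  refine le_trans (Real.exp_le_exp.2 hj') ?_
  exact Finset.single_le_sum (f := fun i => Real.exp (h.eigenvalues i))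
    (fun i _ => (Real.exp_pos _).le) (Finset.mem_univ j)

lemma trE_le {A : Matrix ι ι ℝ} (h : A.IsHermitian) {y : ℝ} (hy : 0 < y)
    (h0 : ∀ w, 0 ≤ w ⬝ᵥ (A *ᵥ w)) (h1 : ∀ w, w ⬝ᵥ (A *ᵥ w) ≤ y * (w ⬝ᵥ w)) :
    trE A ≤ Fintype.card ι + trace A / y * (Real.exp y - 1) := by
  rw [trE_eq h]
  have htr : trace A = ∑ j, h.eigenvalues j := by
    simpa using h.trace_eq_sum_eigenvalues
  have hpt : ∀ j, Real.exp (h.eigenvalues j) ≤ 1 + h.eigenvalues j / y * (Real.exp y - 1) := by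
    intro j
    have a0 := eig_ge h (L := 0) (fun w => by simpa using h0 w) j
    have a1 := eig_le h h1 j
    set l := h.eigenvalues j
    have hc := convexOn_exp.2 (Set.mem_univ 0) (Set.mem_univ y)
      (sub_nonneg.2 ((div_le_one hy).2 a1)) (div_nonneg a0 hy.le) (by ring)
    simp only [smul_eq_mul, mul_zero, zero_add, Real.exp_zero] at hc
    rw [div_mul_cancel₀ _ hy.ne'] at hc
    linarith
  refine (Finset.sum_le_sum fun j _ => hpt j).trans (le_of_eq ?_)
  rw [Finset.sum_add_distrib, ← Finset.sum_mul, ← Finset.sum_div, ← htr]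
  simp

open Classical in
lemma bern_one {Ω : Type*} [Fintype Ω] [Nonempty Ω] {n : ℕ}
    (Z : Fin n → Ω → Matrix ι ι ℝ) (hZ : ∀ i ω, (Z i ω).IsHermitian)
    (hmean : ∀ i, ∑ ω, Z i ω = 0) {L v t : ℝ} (hL : 0 ≤ L) (hv : 0 < v) (ht : 0 < t)
    (hZL : ∀ i ω w, w ⬝ᵥ (Z i ω *ᵥ w) ≤ L * (w ⬝ᵥ w))
    (V : Matrix ι ι ℝ) (hV : V = (Fintype.card Ω : ℝ)⁻¹ • ∑ i, ∑ ω, Z i ω * Z i ω)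
    (hVv : ∀ w, w ⬝ᵥ (V *ᵥ w) ≤ v * (w ⬝ᵥ w)) (u : ℝ) (hu : u = t ^ 2 / 2 / (v + L * t / 3)) :
    ((Finset.univ.filter fun ω : Fin n → Ω =>
      ∃ w, t * (w ⬝ᵥ w) < w ⬝ᵥ ((∑ i, Z i (ω i)) *ᵥ w)).card : ℝ) ≤
    (Fintype.card Ω : ℝ) ^ n * (Real.exp (-u) * Real.exp (-u) * (Fintype.card ι - trace V / v) +
      trace V / v * Real.exp (-u)) := by
  set N : ℝ := (Fintype.card Ω : ℝ) with hN
  have hNpos : 0 < N := by rw [hN]; exact_mod_cast Fintype.card_pos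
  have hden : 0 < v + L * t / 3 := by positivity
  set θ := t / (v + L * t / 3) with hθ
  have hθpos : 0 < θ := by positivity
  have h1 : 1 - θ * L / 3 = v / (v + L * t / 3) := by
    rw [hθ]; field_simp; ring
  have hθL : θ * L < 3 := by
    have : 0 < v / (v + L * t / 3) := by positivity
    linarith
  set g := 1 / 2 / (1 - θ * L / 3) with hg
  have hgpos : 0 < g := by rw [hg, h1]; positivity
  have hgv : g * θ ^ 2 * v = u := by
    rw [hg, h1, hu, hθ]; field_simp
  have hθt : θ * t = u + u := by
    rw [hu, hθ]; field_simp; ring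
  have hupos : 0 < u := by rw [hu]; positivity
  have hθZ : ∀ i ω, (θ • Z i ω).IsHermitian := fun i ω => by
    unfold Matrix.IsHermitian
    rw [conjTranspose_smul, (hZ i ω).eq]; simp
  have hZZ : ∀ i ω, (Z i ω * Z i ω).IsHermitian := fun i ω => by
    unfold Matrix.IsHermitian
    rw [conjTranspose_mul, (hZ i ω).eq]
  have hsumH : ∀ {κ : Type _} (s : Finset κ) (F : κ → Matrix ι ι ℝ) (_ : ∀ k, (F k).IsHermitian),
      (∑ k ∈ s, F k).IsHermitian := fun s F hF => by
    unfold Matrix.IsHermitian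
    rw [conjTranspose_sum]
    exact Finset.sum_congr rfl fun k _ => hF k
  have hsmH : ∀ (c : ℝ) (F : Matrix ι ι ℝ) (_ : F.IsHermitian), (c • F).IsHermitian :=
    fun c F hF => by
      unfold Matrix.IsHermitian
      rw [conjTranspose_smul, hF.eq]; simp
  have hZZs : ∀ i, (∑ ω, Z i ω * Z i ω).IsHermitian := fun i => by
    unfold Matrix.IsHermitian
    rw [conjTranspose_sum]
    exact Finset.sum_congr rfl fun k _ => hZZ i k
  have hVh : V.IsHermitian := by
    rw [hV]; exact hsmH _ _ (hsumH _ _ hZZs)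
  have main := lieb_sum g n (fun i ω => θ • Z i ω) hθZ ?_ ?_
    (fun i => (g * θ ^ 2 * N⁻¹) • ∑ ω, Z i ω * Z i ω) (fun i => hsmH _ _ (hZZs i)) ?_ 0
    (by simp [Matrix.IsHermitian])
  · rw [zero_add, ← Finset.smul_sum, mul_smul, ← hV] at main
    have hquad : ∀ w, w ⬝ᵥ ((((g * θ ^ 2) • V)) *ᵥ w) = g * θ ^ 2 * (w ⬝ᵥ (V *ᵥ w)) := fun w => by
      rw [smul_mulVec, dotProduct_smul, smul_eq_mul]
    have hVnn : ∀ w, 0 ≤ w ⬝ᵥ (V *ᵥ w) := fun w => by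
      rw [hV, smul_mulVec, dotProduct_smul, smul_eq_mul, sum_mulVec, dotProduct_sum]
      refine mul_nonneg (inv_pos.2 hNpos).le (Finset.sum_nonneg fun i _ => ?_)
      rw [sum_mulVec, dotProduct_sum]
      refine Finset.sum_nonneg fun ω _ => ?_
      have hT : (Z i ω)ᵀ = Z i ω := by
        have := (hZ i ω).eq
        rwa [conjTranspose_eq_transpose_of_trivial] at this
      rw [← mulVec_mulVec, dotProduct_mulVec w, ← mulVec_transpose, hT]
      exact Finset.sum_nonneg fun j _ => mul_self_nonneg _
    have hup := trE_le (hsmH (g * θ ^ 2) V hVh) hupos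
      (fun w => by rw [hquad]; exact mul_nonneg (by positivity) (hVnn w))
      (fun w => by
        rw [hquad, ← hgv, mul_assoc (g * θ ^ 2)]
        exact mul_le_mul_of_nonneg_left (hVv w) (by positivity))
    have hd : trace ((g * θ ^ 2) • V) / u = trace V / v := by
      rw [trace_smul, smul_eq_mul, ← hgv]
      have : g * θ ^ 2 ≠ 0 := by positivity
      field_simp
    rw [hd] at hup
    have hlow : ((Finset.univ.filter fun ω : Fin n → Ω =>
      ∃ w, t * (w ⬝ᵥ w) < w ⬝ᵥ ((∑ i, Z i (ω i)) *ᵥ w)).card : ℝ) * Real.exp (u + u) ≤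
        ∑ ω : Fin n → Ω, trE (0 + ∑ i, θ • Z i (ω i)) := by
      rw [← nsmul_eq_mul, ← Finset.sum_const]
      refine le_trans (Finset.sum_le_sum fun ω hω => ?_)
        (Finset.sum_le_sum_of_subset_of_nonneg (Finset.filter_subset _ _)
          fun ω _ _ => trE_nonneg _)
      obtain ⟨w, hw⟩ := (Finset.mem_filter.1 hω).2
      rw [zero_add, ← hθt]
      refine trE_ge (w := w) (hsumH _ _ fun i => hθZ i _) ?_
      rw [← Finset.smul_sum, smul_mulVec, dotProduct_smul, smul_eq_mul, mul_assoc]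
      exact mul_lt_mul_of_pos_left hw hθpos
    have hfin := hlow.trans (main.trans (mul_le_mul_of_nonneg_left hup (by positivity)))
    rw [← le_div_iff₀ (Real.exp_pos _)] at hfin
    refine hfin.trans (le_of_eq ?_)
    rw [Real.exp_neg, Real.exp_add]
    have := Real.exp_pos u
    field_simp
    ring
  · intro i ω j
    refine exp_bern (eig_le (hθZ i ω) (fun w => ?_) j) (by positivity) hθL
    rw [smul_mulVec, dotProduct_smul, smul_eq_mul, mul_assoc]
    exact mul_le_mul_of_nonneg_left (hZL i ω w) hθpos.le
  · intro i
    rw [← Finset.smul_sum, hmean, smul_zero]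
  · intro i
    simp only [Matrix.smul_mul, Matrix.mul_smul, smul_smul, ← Finset.smul_sum]
    congr 1
    field_simp
    rfl

end C

lemma specNorm_ge_aux {p : ℕ} {S : Matrix (Fin p) (Fin p) ℝ} (h : S.IsHermitian) {t : ℝ}
    (ht : 0 ≤ t) (hS : ∀ w, |w ⬝ᵥ (S *ᵥ w)| ≤ t * (w ⬝ᵥ w)) :
    ‖LinearMap.toContinuousLinearMap (Matrix.toEuclideanLin S)‖ ≤ t := by
  refine ContinuousLinearMap.opNorm_le_bound _ ht fun w => ?_
  obtain ⟨U, h1, h2, h3, h4⟩ := quad_spec h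
  have e1 : ∀ j, h.eigenvalues j ^ 2 ≤ t ^ 2 := by
    intro j
    obtain ⟨w, a, b⟩ := h4 j
    have := hS w
    rw [a, b, mul_one] at this
    exact sq_le_sq' (abs_le.1 this).1 (abs_le.1 this).2
  have e2 : (S *ᵥ w.ofLp) ⬝ᵥ (S *ᵥ w.ofLp) ≤ t ^ 2 * (w.ofLp ⬝ᵥ w.ofLp) := by
    rw [h3, h2, Finset.mul_sum]
    exact Finset.sum_le_sum fun j _ => mul_le_mul_of_nonneg_right (e1 j) (sq_nonneg _)
  refine le_of_sq_le_sq ?_ (by positivity)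
  rw [mul_pow, EuclideanSpace.real_norm_sq_eq, EuclideanSpace.real_norm_sq_eq]
  simpa [dotProduct, sq] using e2

lemma quad_le_specNorm_aux {p : ℕ} (S : Matrix (Fin p) (Fin p) ℝ) (w : Fin p → ℝ) :
    w ⬝ᵥ (S *ᵥ w) ≤ ‖LinearMap.toContinuousLinearMap (Matrix.toEuclideanLin S)‖ * (w ⬝ᵥ w) := by
  set x : EuclideanSpace ℝ (Fin p) := WithLp.toLp 2 w
  have h1 := real_inner_le_norm x ((LinearMap.toContinuousLinearMap (Matrix.toEuclideanLin S)) x)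
  have h2 := (LinearMap.toContinuousLinearMap (Matrix.toEuclideanLin S)).le_opNorm x
  have h3 : inner ℝ x ((LinearMap.toContinuousLinearMap (Matrix.toEuclideanLin S)) x) =
      w ⬝ᵥ (S *ᵥ w) := by
    simp [x, PiLp.inner_apply, dotProduct, mul_comm]
  have h4 : w ⬝ᵥ w = ‖x‖ ^ 2 := by
    rw [EuclideanSpace.real_norm_sq_eq]; simp [x, dotProduct, sq]
  rw [h3] at h1
  rw [h4]
  nlinarith [norm_nonneg x]

lemma log_aux {p : ℕ} (hp : 3 ≤ p) :
    2 * (1 + 2 * ((p : ℝ) - 2) * (1 - 1 / p)) ≤ p * (1 + Real.log p) := by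
  rcases Nat.lt_or_ge p 4 with h | h
  · have : p = 3 := by omega
    subst this
    have : (1 : ℝ) ≤ Real.log (3 : ℕ) := by
      rw [Real.le_log_iff_exp_le (by norm_num)]
      have := Real.exp_one_lt_d9
      push_cast; linarith
    norm_num at this ⊢
    linarith
  · have h4 : (4 : ℝ) ≤ p := by exact_mod_cast h
    have hp0 : (0 : ℝ) < p := by linarith
    have h1 : 3 - 8 / (p : ℝ) ≤ Real.log p := by
      have e : Real.log p = 3 * Real.log 2 + Real.log (p / 8) := by
        rw [Real.log_div hp0.ne' (by norm_num), show (8 : ℝ) = 2 ^ 3 by norm_num, Real.log_pow]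
        push_cast; ring
      have := Real.log_two_gt_d9
      have := Real.one_sub_inv_le_log_of_pos (show 0 < (p : ℝ) / 8 by positivity)
      rw [inv_div] at this
      linarith
    have h2 : (p : ℝ) * (1 + (3 - 8 / p)) ≤ p * (1 + Real.log p) := by gcongr
    refine le_trans ?_ h2
    have h3 : (p : ℝ) * (1 + (3 - 8 / p)) = 4 * p - 8 := by field_simp; ring
    rw [h3]
    have h5 : 2 * (1 + 2 * ((p : ℝ) - 2) * (1 - 1 / p)) = 4 * p - 10 + 8 / p := by
      field_simp; ring
    rw [h5]
    have : 8 / (p : ℝ) ≤ 2 := by rw [div_le_iff₀ hp0]; linarith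
    linarith

lemma inv_sum_aux {a b k : ℝ} (ha : 0 ≤ a) (hb : 0 ≤ b) (hk : 0 ≤ k) (h : k ^ 2 ≤ a * b) :
    (1 ≤ k → 1 / (1 + a) + 1 / (1 + b) ≤ 1) ∧
    (k ≤ 1 → 1 / (1 + a) + 1 / (1 + b) ≤ 2 / (1 + k)) := by
  have hS : 2 * k ≤ a + b := by
    apply le_of_sq_le_sq _ (by positivity)
    nlinarith [sq_nonneg (a - b)]
  have e : 1 / (1 + a) + 1 / (1 + b) = (2 + a + b) / ((1 + a) * (1 + b)) := by
    field_simp; ring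
  rw [e]
  constructor
  · intro h1
    rw [div_le_one (by positivity)]
    nlinarith
  · intro h1
    rw [div_le_div_iff₀ (by positivity) (by positivity)]
    nlinarith [mul_nonneg (sub_nonneg.2 hS) (sub_nonneg.2 h1)]

set_option maxHeartbeats 1000000 in
lemma final_scalar {p : ℕ} (hp : 3 ≤ p) {v s Lp Lm t d u up um : ℝ} (hs : 0 < s)
    (hv : s / 2 ≤ v) (hLp : 0 ≤ Lp) (hLm : 0 ≤ Lm) (ht : 0 < t) (hd0 : 0 ≤ d)
    (hd : d * v ≤ (p - 2) * s) (hdp : d ≤ p)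
    (hu : u = t ^ 2 / 2 / (v + s / 2 + (Lp + Lm) * t / 3)) (hlog : Real.log p ≤ u)
    (hup : up = t ^ 2 / 2 / (v + Lp * t / 3)) (hum : um = t ^ 2 / 2 / (v + Lm * t / 3)) :
    (Real.exp (-up) * Real.exp (-up) * (p - d) + d * Real.exp (-up)) +
    (Real.exp (-um) * Real.exp (-um) * (p - d) + d * Real.exp (-um)) ≤ p * Real.exp (-u) := by
  have hp3 : (3 : ℝ) ≤ p := by exact_mod_cast hp
  have hp0 : (0 : ℝ) < p := by linarith
  have hv0 : 0 < v := by linarith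
  have hu0 : 0 < u := by rw [hu]; positivity
  set a := Lp * t / 3 with ha
  set b := Lm * t / 3 with hb
  have ha0 : 0 ≤ a := by positivity
  have hb0 : 0 ≤ b := by positivity
  have hu' : u = t ^ 2 / 2 / (v + s / 2 + a + b) := by rw [hu, ha, hb]; congr 1; ring
  set X := (s / 2 + b) / (v + a) with hX
  set Y := (s / 2 + a) / (v + b) with hY
  set K := (s / 2) / v with hK
  have hX0 : 0 ≤ X := by positivity
  have hY0 : 0 ≤ Y := by positivity
  have hK0 : 0 ≤ K := by positivity
  have hK1 : K ≤ 1 := by rw [hK, div_le_one hv0]; exact hv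
  have hupX : up = u + u * X := by
    rw [hup, hu', hX]; field_simp; ring
  have humY : um = u + u * Y := by
    rw [hum, hu', hY]; field_simp; ring
  have hXY : K ^ 2 ≤ X * Y := by
    rw [hX, hY, hK, div_mul_div_comm, div_pow, div_le_div_iff₀ (by positivity) (by positivity)]
    have h1 : s / 2 * (v + a) ≤ (s / 2 + a) * v := by
      linarith [mul_le_mul_of_nonneg_left hv ha0]
    have h2 : s / 2 * (v + b) ≤ (s / 2 + b) * v := by
      linarith [mul_le_mul_of_nonneg_left hv hb0]
    have := mul_le_mul h1 h2 (by positivity) (by positivity)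
    linarith
  have key := inv_sum_aux (a := u * X) (b := u * Y) (k := u * K) (by positivity) (by positivity)
    (by positivity) (by linarith [mul_le_mul_of_nonneg_left hXY (sq_nonneg u)])
  clear_value X Y K a b
  have hE : Real.exp (-u) * p ≤ 1 := by
    rw [Real.exp_neg, inv_mul_le_iff₀ (Real.exp_pos _), mul_one]
    exact (Real.log_le_iff_le_exp hp0).1 hlog
  have one : ∀ w W : ℝ, 0 ≤ W → w = u + u * W →
      Real.exp (-w) * Real.exp (-w) * (p - d) + d * Real.exp (-w) ≤
      Real.exp (-u) * ((1 + d * (1 - 1 / p)) * (1 / (1 + u * W))) := by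
    intro w W hW hw
    have h1 : Real.exp (-w) = Real.exp (-u) * Real.exp (-(u * W)) := by
      rw [← Real.exp_add, hw]; congr 1; ring
    have h2 : Real.exp (-(u * W)) ≤ 1 / (1 + u * W) := by
      rw [Real.exp_neg, ← one_div]
      apply one_div_le_one_div_of_le (by positivity)
      linarith [Real.add_one_le_exp (u * W)]
    have h3 : Real.exp (-w) ≤ Real.exp (-u) := by
      apply Real.exp_le_exp.2; rw [hw]; linarith [mul_nonneg hu0.le hW]
    have h4 : Real.exp (-w) * (p - d) ≤ 1 - d / p := by
      have : Real.exp (-w) ≤ 1 / p := by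
        rw [le_div_iff₀ hp0]; exact (mul_le_mul_of_nonneg_right h3 hp0.le).trans hE
      calc Real.exp (-w) * (p - d) ≤ 1 / p * (p - d) :=
            mul_le_mul_of_nonneg_right this (by linarith)
        _ = _ := by field_simp
    have h5 : 0 ≤ 1 + d * (1 - 1 / p) := by
      have : 1 / (p : ℝ) ≤ 1 := by rw [div_le_one hp0]; linarith
      have := mul_nonneg hd0 (sub_nonneg.2 this)
      linarith
    calc Real.exp (-w) * Real.exp (-w) * (p - d) + d * Real.exp (-w)
        = Real.exp (-w) * (Real.exp (-w) * (p - d) + d) := by ring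
      _ ≤ Real.exp (-w) * (1 - d / p + d) :=
          mul_le_mul_of_nonneg_left (by linarith) (Real.exp_pos _).le
      _ = Real.exp (-u) * ((1 + d * (1 - 1 / p)) * Real.exp (-(u * W))) := by rw [h1]; ring
      _ ≤ _ := mul_le_mul_of_nonneg_left (mul_le_mul_of_nonneg_left h2 h5) (Real.exp_pos _).le
  refine (add_le_add (one up X hX0 hupX) (one um Y hY0 humY)).trans ?_
  rw [← mul_add, ← mul_add, mul_comm (p : ℝ)]
  refine mul_le_mul_of_nonneg_left ?_ (Real.exp_pos _).le
  have hip : 1 / (p : ℝ) ≤ 1 := by rw [div_le_one hp0]; linarith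
  have h5 : 0 ≤ 1 + d * (1 - 1 / p) := by
    have := mul_nonneg hd0 (sub_nonneg.2 hip)
    linarith
  rcases le_total 1 (u * K) with hk | hk
  · refine (mul_le_mul_of_nonneg_left (key.1 hk) h5).trans ?_
    have : d * (1 - 1 / p) ≤ p * (1 - 1 / p) :=
      mul_le_mul_of_nonneg_right hdp (sub_nonneg.2 hip)
    have e : (p : ℝ) * (1 - 1 / p) = p - 1 := by field_simp
    linarith
  · refine (mul_le_mul_of_nonneg_left (key.2 hk) h5).trans ?_
    have hk0 : 0 < 1 + u * K := by positivity
    rw [← mul_div_assoc, div_le_iff₀ hk0]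
    have hdK : d ≤ 2 * (p - 2) * K := by
      rw [hK, ← mul_div_assoc, le_div_iff₀ hv0]; linarith
    have h6 : d * (1 - 1 / p) ≤ 2 * (p - 2) * K * (1 - 1 / p) :=
      mul_le_mul_of_nonneg_right hdK (sub_nonneg.2 hip)
    have h7 := log_aux hp
    have h8 : (p : ℝ) * (1 + Real.log p) ≤ p * (1 + u) := by gcongr
    have h9 := mul_le_mul_of_nonneg_left (h7.trans h8) hK0
    nlinarith [mul_nonneg (sub_nonneg.2 hK1) (show (0:ℝ) ≤ p - 2 by linarith)]

/-- Indicator of the sampled coordinates. -/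
noncomputable def chi {p m : ℕ} (σ : Fin m ↪ Fin p) (i : Fin p) : ℝ :=
  open Classical in if i ∈ Set.range σ then 1 else 0

lemma chi_sq {p m : ℕ} (σ : Fin m ↪ Fin p) (i : Fin p) : chi σ i * chi σ i = chi σ i := by
  unfold chi; split_ifs <;> simp

lemma chi_eq_sum {p m : ℕ} (σ : Fin m ↪ Fin p) (i : Fin p) :
    chi σ i = ∑ j, if σ j = i then 1 else 0 := by
  unfold chi
  split_ifs with h
  · obtain ⟨j, rfl⟩ := h
    simp
  · symm
    apply Finset.sum_eq_zero
    intro j _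
    rw [if_neg]
    intro hj; exact h ⟨j, hj⟩

lemma chi_sum {p m : ℕ} (σ : Fin m ↪ Fin p) : ∑ i, chi σ i = m := by
  simp only [chi_eq_sum]
  rw [Finset.sum_comm]
  simp

lemma chi_trans {p m : ℕ} (σ : Fin m ↪ Fin p) (π : Equiv.Perm (Fin p)) (i : Fin p) :
    chi (σ.trans π.toEmbedding) (π i) = chi σ i := by
  unfold chi
  congr 1
  simp

lemma chi_perm {p m : ℕ} (π : Equiv.Perm (Fin p)) (i j : Fin p) :
    ∑ σ : Fin m ↪ Fin p, chi σ (π i) * chi σ (π j) = ∑ σ : Fin m ↪ Fin p, chi σ i * chi σ j := by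
  let e : (Fin m ↪ Fin p) ≃ (Fin m ↪ Fin p) := Equiv.embeddingCongr (Equiv.refl _) π
  rw [← e.sum_comp]
  refine Finset.sum_congr rfl fun σ _ => ?_
  have : e σ = σ.trans π.toEmbedding := by ext k; simp [e]
  rw [this, chi_trans, chi_trans]

lemma chi_count {p m : ℕ} (hm : 2 ≤ m) (hmp : m ≤ p) (i j : Fin p) :
    ∑ σ : Fin m ↪ Fin p, chi σ i * chi σ j =
      (Fintype.card (Fin m ↪ Fin p) : ℝ) / (((p : ℝ) * ((p : ℝ) - 1)) / ((m : ℝ) * ((m : ℝ) - 1))) *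
       (1 + if i = j then ((p : ℝ) - m) / ((m : ℝ) - 1) else 0) := by
  have hm' : (2 : ℝ) ≤ m := by exact_mod_cast hm
  have hp' : (m : ℝ) ≤ p := by exact_mod_cast hmp
  set N : ℝ := (Fintype.card (Fin m ↪ Fin p) : ℝ)
  have h1 : ∀ i : Fin p, ∑ σ : Fin m ↪ Fin p, chi σ i * chi σ i = N * m / p := by
    intro i
    have hc : ∀ k : Fin p, ∑ σ : Fin m ↪ Fin p, chi σ k * chi σ k =
        ∑ σ : Fin m ↪ Fin p, chi σ i * chi σ i := by
      intro k
      have := chi_perm (m := m) (Equiv.swap i k) i i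
      simpa using this
    have hs : ∑ k, ∑ σ : Fin m ↪ Fin p, chi σ k * chi σ k = N * m := by
      rw [Finset.sum_comm]
      simp only [chi_sq, chi_sum]
      simp [N]
    rw [Finset.sum_congr rfl fun k _ => hc k] at hs
    simp only [sum_const, card_univ, Fintype.card_fin, nsmul_eq_mul] at hs
    rw [eq_div_iff (by linarith), mul_comm]; exact hs
  have hm1 : (m : ℝ) - 1 ≠ 0 := by linarith
  have hp1 : (p : ℝ) - 1 ≠ 0 := by linarith
  have hm0 : (m : ℝ) ≠ 0 := by linarith
  have hp0 : (p : ℝ) ≠ 0 := by linarith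
  by_cases hij : i = j
  · subst hij
    rw [h1, if_pos rfl]
    field_simp
    ring
  · rw [if_neg hij]
    have hc : ∀ k, k ≠ i → ∑ σ : Fin m ↪ Fin p, chi σ i * chi σ k =
        ∑ σ : Fin m ↪ Fin p, chi σ i * chi σ j := by
      intro k hk
      have := chi_perm (m := m) (Equiv.swap j k) i j
      rw [Equiv.swap_apply_of_ne_of_ne hij (Ne.symm hk), Equiv.swap_apply_left] at this
      exact this
    have hs : ∑ k, ∑ σ : Fin m ↪ Fin p, chi σ i * chi σ k = N * m / p * m := by
      rw [Finset.sum_comm]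
      simp only [← Finset.mul_sum, chi_sum]
      rw [← Finset.sum_mul, ← h1 i]
      simp only [chi_sq]
    rw [← Finset.add_sum_erase _ _ (Finset.mem_univ i), h1 i,
      Finset.sum_congr rfl fun k hk => hc k (Finset.ne_of_mem_erase hk)] at hs
    simp only [sum_const, Finset.card_erase_of_mem (Finset.mem_univ i), card_univ, Fintype.card_fin,
      nsmul_eq_mul] at hs
    rw [Nat.cast_sub (by omega)] at hs
    have : ∑ σ : Fin m ↪ Fin p, chi σ i * chi σ j = (N * m / p * m - N * m / p) / (p - 1) := by
      rw [eq_div_iff hp1]; push_cast at hs; linarith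
    rw [this]
    field_simp
    ring

section abs
variable {p : ℕ} {Ω : Type*} [Fintype Ω] {χ : Ω → Fin p → ℝ} {N c β : ℝ}

lemma cnt2 (hcnt : ∀ i j, ∑ ω, χ ω i * χ ω j = N / c * (1 + if i = j then β else 0))
    (f g : Fin p → ℝ) : ∑ ω, (∑ i, χ ω i * f i) * (∑ i, χ ω i * g i) =
      N / c * ((∑ i, f i) * (∑ i, g i) + β * ∑ i, f i * g i) := by
  have : ∀ ω, (∑ i, χ ω i * f i) * (∑ i, χ ω i * g i) =
      ∑ i, ∑ j, (f i * g j) * (χ ω i * χ ω j) := fun ω => by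
    rw [Finset.sum_mul_sum]
    exact Finset.sum_congr rfl fun i _ => Finset.sum_congr rfl fun j _ => by ring
  simp only [this]
  rw [Finset.sum_comm]
  have h2 : ∀ i, ∑ ω, ∑ j, (f i * g j) * (χ ω i * χ ω j) =
      N / c * (f i * ∑ j, g j) + N / c * (β * (f i * g i)) := fun i => by
    rw [Finset.sum_comm]
    simp only [← Finset.mul_sum, hcnt]
    simp only [mul_add, Finset.sum_add_distrib, mul_ite, mul_zero, mul_one, Finset.sum_ite_eq,
      Finset.mem_univ, if_true, Finset.mul_sum]
    congr 1
    · exact Finset.sum_congr rfl fun j _ => by ring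
    · ring
  simp only [h2, Finset.sum_add_distrib, ← Finset.mul_sum]
  rw [Finset.sum_mul]; ring

lemma cnt1 (hχ : ∀ ω i, χ ω i * χ ω i = χ ω i)
    (hcnt : ∀ i j, ∑ ω, χ ω i * χ ω j = N / c * (1 + if i = j then β else 0))
    (f : Fin p → ℝ) : ∑ ω, (∑ i, χ ω i * f i) = N / c * (1 + β) * ∑ i, f i := by
  rw [Finset.sum_comm, Finset.mul_sum]
  refine Finset.sum_congr rfl fun i _ => ?_
  rw [← Finset.sum_mul]
  congr 1
  rw [Finset.sum_congr rfl fun ω _ => (hχ ω i).symm, hcnt, if_pos rfl]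

end abs

/-- The centred summand attached to a data vector `x` and a mask `χ`. -/
noncomputable def Zmat {p : ℕ} (r c α : ℝ) (x χ : Fin p → ℝ) : Matrix (Fin p) (Fin p) ℝ :=
  r • (c • vecMulVec (fun i => χ i * x i) (fun i => χ i * x i) -
    (c * α) • diagonal (fun i => χ i * x i ^ 2) - vecMulVec x x)

lemma vecMulVec_herm {p : ℕ} (y : Fin p → ℝ) : (vecMulVec y y).IsHermitian := by
  ext i j; simp [vecMulVec_apply, mul_comm]

lemma Zmat_herm {p : ℕ} (r c α : ℝ) (x χ : Fin p → ℝ) : (Zmat r c α x χ).IsHermitian := by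
  ext i j
  simp [Zmat, vecMulVec_apply, diagonal_apply]
  by_cases h : i = j
  · subst h; simp
  · rw [if_neg h, if_neg (Ne.symm h)]; left; ring

lemma Zmat_mulVec {p : ℕ} (r c α : ℝ) (x χ w : Fin p → ℝ) :
    Zmat r c α x χ *ᵥ w = fun i => r * (c * (χ i * x i) * (∑ k, χ k * (x k * w k)) -
      c * α * (χ i * x i ^ 2) * w i - x i * ∑ k, x k * w k) := by
  ext i
  rw [Zmat, smul_mulVec, sub_mulVec, sub_mulVec, smul_mulVec, smul_mulVec]
  simp only [Pi.smul_apply, Pi.sub_apply, smul_eq_mul, mulVec_diagonal, vecMulVec_mulVec]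
  simp [dotProduct, mul_assoc, mul_comm, mul_left_comm]

lemma Zmat_quad {p : ℕ} (r c α : ℝ) (x χ w : Fin p → ℝ) :
    w ⬝ᵥ (Zmat r c α x χ *ᵥ w) = r * (c * (∑ k, χ k * (x k * w k)) ^ 2 -
      c * α * (∑ k, χ k * (x k ^ 2 * w k ^ 2)) - (∑ k, x k * w k) ^ 2) := by
  rw [Zmat_mulVec, dotProduct]
  have : ∀ i, w i * (r * (c * (χ i * x i) * (∑ k, χ k * (x k * w k)) -
      c * α * (χ i * x i ^ 2) * w i - x i * ∑ k, x k * w k)) =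
      r * (c * (∑ k, χ k * (x k * w k))) * (χ i * (x i * w i)) -
      r * (c * α) * (χ i * (x i ^ 2 * w i ^ 2)) - r * (∑ k, x k * w k) * (x i * w i) := by
    intro i; ring
  simp only [this, Finset.sum_sub_distrib, ← Finset.mul_sum]
  ring

lemma Zmat_normsq {p : ℕ} (r c α : ℝ) (x χ w : Fin p → ℝ) (hχ : ∀ i, χ i * χ i = χ i) :
    (Zmat r c α x χ *ᵥ w) ⬝ᵥ (Zmat r c α x χ *ᵥ w) = r ^ 2 * (
      c ^ 2 * (∑ k, χ k * x k ^ 2) * (∑ k, χ k * (x k * w k)) ^ 2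
      - 2 * c ^ 2 * α * ((∑ k, χ k * (x k * w k)) * (∑ k, χ k * (x k ^ 3 * w k)))
      + c ^ 2 * α ^ 2 * (∑ k, χ k * (x k ^ 4 * w k ^ 2))
      - 2 * (∑ k, x k * w k) * (c * ((∑ k, χ k * x k ^ 2) * (∑ k, χ k * (x k * w k)))
         - c * α * (∑ k, χ k * (x k ^ 3 * w k)))
      + (∑ k, x k ^ 2) * (∑ k, x k * w k) ^ 2) := by
  rw [Zmat_mulVec, dotProduct]
  set S := ∑ k, χ k * (x k * w k)
  set T := ∑ k, x k * w k
  have : ∀ i, (r * (c * (χ i * x i) * S - c * α * (χ i * x i ^ 2) * w i - x i * T)) *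
     (r * (c * (χ i * x i) * S - c * α * (χ i * x i ^ 2) * w i - x i * T)) =
      r ^ 2 * c ^ 2 * S ^ 2 * (χ i * x i ^ 2) - r ^ 2 * 2 * c ^ 2 * α * S * (χ i * (x i ^ 3 * w i))
      + r ^ 2 * c ^ 2 * α ^ 2 * (χ i * (x i ^ 4 * w i ^ 2))
      - r ^ 2 * 2 * T * c * S * (χ i * x i ^ 2) + r ^ 2 * 2 * T * c * α * (χ i * (x i ^ 3 * w i))
      + r ^ 2 * T ^ 2 * x i ^ 2 := by
    intro i
    linear_combination (r ^ 2 * (c * x i * S - c * α * x i ^ 2 * w i) ^ 2) * hχ i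
  simp only [this, Finset.sum_sub_distrib, Finset.sum_add_distrib, ← Finset.mul_sum]
  ring

lemma Zmat_trace {p : ℕ} (r c α : ℝ) (x χ : Fin p → ℝ) (hχ : ∀ i, χ i * χ i = χ i) :
    trace (Zmat r c α x χ * Zmat r c α x χ) = r ^ 2 * (
      c ^ 2 * (∑ k, χ k * x k ^ 2) * (∑ k, χ k * x k ^ 2)
      - (2 * c ^ 2 * α - c ^ 2 * α ^ 2) * (∑ k, χ k * x k ^ 4)
      - 2 * c * ((∑ k, χ k * x k ^ 2) * (∑ k, χ k * x k ^ 2))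
      + 2 * c * α * (∑ k, χ k * x k ^ 4) + (∑ k, x k ^ 2) ^ 2) := by
  have h : trace (Zmat r c α x χ * Zmat r c α x χ) = ∑ i, ∑ j, (Zmat r c α x χ i j) ^ 2 := by
    simp only [trace, diag_apply, mul_apply]
    refine Finset.sum_congr rfl fun i _ => Finset.sum_congr rfl fun j _ => ?_
    have : Zmat r c α x χ j i = Zmat r c α x χ i j := by
      have := (Zmat_herm r c α x χ).apply i j
      simpa using this
    rw [this, sq]
  rw [h]
  have e : ∀ i j, (Zmat r c α x χ i j) ^ 2 = r ^ 2 * (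
      c ^ 2 * ((χ i * x i ^ 2) * (χ j * x j ^ 2))
      - (if i = j then (2 * c ^ 2 * α - c ^ 2 * α ^ 2) * (χ i * x i ^ 4) else 0)
      - 2 * c * ((χ i * x i ^ 2) * (χ j * x j ^ 2))
      + (if i = j then 2 * c * α * (χ i * x i ^ 4) else 0) + x i ^ 2 * x j ^ 2) := by
    intro i j
    simp only [Zmat, Matrix.smul_apply, Matrix.sub_apply, vecMulVec_apply, smul_eq_mul, diagonal_apply]
    by_cases hij : i = j
    · subst hij
      rw [if_pos rfl, if_pos rfl, if_pos rfl]
      have h1 : χ i = 0 ∨ χ i = 1 := by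
        have : χ i * (χ i - 1) = 0 := by linear_combination hχ i
        rcases mul_eq_zero.1 this with h | h
        · exact Or.inl h
        · exact Or.inr (by linarith)
      rcases h1 with h1 | h1 <;> rw [h1] <;> ring
    · rw [if_neg hij, if_neg hij, if_neg hij]
      have h1 := hχ i
      have h2 := hχ j
      have h3 : (χ i * χ j) ^ 2 = χ i * χ j := by
        rw [mul_pow, sq, sq, h1, h2]
      linear_combination (r ^ 2 * c ^ 2 * x i ^ 2 * x j ^ 2) * h3
  simp only [e, Finset.sum_sub_distrib, Finset.sum_add_distrib, ← Finset.mul_sum,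
    Finset.sum_ite_eq, Finset.mem_univ, if_true, ← Finset.sum_mul]
  ring

lemma cross_bound {p : ℕ} (x w : Fin p → ℝ) {μ : ℝ} (hμ : 0 < μ) (hx : ∀ i, |x i| ≤ μ) :
    -2 * ((∑ k, x k * w k) * (∑ k, x k ^ 3 * w k)) ≤
      μ ^ 2 / 4 * ((∑ k, x k ^ 2) * (∑ k, w k ^ 2)) := by
  set q := ∑ k, x k * w k
  set r := ∑ k, ((x k ^ 2 - μ ^ 2 / 2) * x k) * w k with hr
  have hS : ∑ k, x k ^ 3 * w k = μ ^ 2 / 2 * q + r := by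
    rw [hr, Finset.mul_sum, ← Finset.sum_add_distrib]
    exact Finset.sum_congr rfl fun k _ => by ring
  have h1 : r ^ 2 ≤ (∑ k, ((x k ^ 2 - μ ^ 2 / 2) * x k) ^ 2) * ∑ k, w k ^ 2 :=
    Finset.sum_mul_sq_le_sq_mul_sq _ _ _
  have h2 : (∑ k, ((x k ^ 2 - μ ^ 2 / 2) * x k) ^ 2) ≤ μ ^ 4 / 4 * ∑ k, x k ^ 2 := by
    rw [Finset.mul_sum]
    refine Finset.sum_le_sum fun k _ => ?_
    rw [mul_pow]
    refine mul_le_mul_of_nonneg_right ?_ (sq_nonneg _)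
    have h3 : x k ^ 2 ≤ μ ^ 2 := sq_le_sq.2 (by rw [abs_of_pos hμ]; exact hx k)
    nlinarith [mul_nonneg (sq_nonneg (x k)) (sub_nonneg.2 h3)]
  have hW : 0 ≤ ∑ k, w k ^ 2 := Finset.sum_nonneg fun k _ => sq_nonneg _
  have h3 := h1.trans (mul_le_mul_of_nonneg_right h2 hW)
  rw [hS]
  set B := (∑ k, x k ^ 2)
  set W := ∑ k, w k ^ 2
  have hμ2 : 0 < μ ^ 2 := by positivity
  refine le_of_mul_le_mul_left ?_ hμ2
  nlinarith [sq_nonneg (μ ^ 2 * q + r)]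

section abs
variable {p : ℕ} {Ω : Type*} [Fintype Ω] {χ : Ω → Fin p → ℝ} {c α β r : ℝ}

lemma Z_mean (hχ : ∀ ω i, χ ω i * χ ω i = χ ω i)
    (hcnt : ∀ i j, ∑ ω, χ ω i * χ ω j = (Fintype.card Ω : ℝ) / c * (1 + if i = j then β else 0))
    (hc : 0 < c) (hab : α * (1 + β) = β) (x : Fin p → ℝ) :
    ∑ ω, Zmat r c α x (χ ω) = 0 := by
  ext i j
  rw [Matrix.sum_apply]
  by_cases hij : i = j
  · subst hij
    have h := hcnt i i
    rw [if_pos rfl] at h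
    have e : ∀ ω, Zmat r c α x (χ ω) i i =
        (r * c * x i ^ 2 * (1 - α)) * (χ ω i * χ ω i) - r * x i ^ 2 := by
      intro ω
      simp only [Zmat, Matrix.smul_apply, Matrix.sub_apply, vecMulVec_apply, smul_eq_mul,
        diagonal_apply, if_true]
      linear_combination (r * c * α * x i ^ 2) * hχ ω i
    simp only [e, Finset.sum_sub_distrib, ← Finset.mul_sum, h]
    simp only [sum_const, card_univ, nsmul_eq_mul, Matrix.zero_apply]
    field_simp
    linear_combination (-(r * x i ^ 2 * (Fintype.card Ω : ℝ))) * hab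
  · have h := hcnt i j
    rw [if_neg hij] at h
    have e : ∀ ω, Zmat r c α x (χ ω) i j =
        (r * c * x i * x j) * (χ ω i * χ ω j) - r * (x i * x j) := by
      intro ω
      simp only [Zmat, Matrix.smul_apply, Matrix.sub_apply, vecMulVec_apply, smul_eq_mul,
        diagonal_apply, if_neg hij]
      ring
    simp only [e, Finset.sum_sub_distrib, ← Finset.mul_sum, h]
    simp only [sum_const, card_univ, nsmul_eq_mul, Matrix.zero_apply]
    field_simp
    ring

lemma Z_trace (hχ : ∀ ω i, χ ω i * χ ω i = χ ω i)
    (hcnt : ∀ i j, ∑ ω, χ ω i * χ ω j = (Fintype.card Ω : ℝ) / c * (1 + if i = j then β else 0))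
    (hc : 0 < c) (hab : α * (1 + β) = β) (hβ : 0 ≤ β) (hα1 : α ≤ 1) (x : Fin p → ℝ) :
    ∑ ω, trace (Zmat r c α x (χ ω) * Zmat r c α x (χ ω)) ≤
      (Fintype.card Ω : ℝ) * r ^ 2 * ((c - 1) * (∑ k, x k ^ 2) ^ 2) := by
  have c2 := cnt2 hcnt (fun i => x i ^ 2) (fun i => x i ^ 2)
  have c1 := cnt1 hχ hcnt (fun i => x i ^ 4)
  set N : ℝ := (Fintype.card Ω : ℝ) with hN
  have hN0 : 0 ≤ N := by positivity
  have e : ∀ ω, trace (Zmat r c α x (χ ω) * Zmat r c α x (χ ω)) =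
      r ^ 2 * (c ^ 2 - 2 * c) * ((∑ k, χ ω k * x k ^ 2) * (∑ k, χ ω k * x k ^ 2))
      - r ^ 2 * (2 * c ^ 2 * α - c ^ 2 * α ^ 2 - 2 * c * α) * (∑ k, χ ω k * x k ^ 4)
      + r ^ 2 * (∑ k, x k ^ 2) ^ 2 := by
    intro ω
    rw [Zmat_trace r c α x (χ ω) (hχ ω)]; ring
  simp only [e, Finset.sum_sub_distrib, Finset.sum_add_distrib, ← Finset.mul_sum, c1, c2]
  simp only [sum_const, card_univ, nsmul_eq_mul, ← hN]
  have hq : ∑ i, x i ^ 2 * x i ^ 2 = ∑ i, x i ^ 4 := Finset.sum_congr rfl fun i _ => by ring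
  rw [hq]
  set Q := ∑ i, x i ^ 4
  set B := ∑ i, x i ^ 2
  have hQ : 0 ≤ Q := Finset.sum_nonneg fun k _ => by positivity
  have : r ^ 2 * (c ^ 2 - 2 * c) * (N / c * (B * B + β * Q)) -
      r ^ 2 * (2 * c ^ 2 * α - c ^ 2 * α ^ 2 - 2 * c * α) * (N / c * (1 + β) * Q) +
      r ^ 2 * (N * B ^ 2) = N * r ^ 2 * ((c - 1) * B ^ 2) - N * r ^ 2 * (c * β * (1 - α) * Q) := by
    field_simp
    linear_combination (-(N * r ^ 2 * Q * (2 * c - c * α - 2))) * hab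
  rw [this]
  have : 0 ≤ N * r ^ 2 * (c * β * (1 - α) * Q) := by
    have := sub_nonneg.2 hα1
    positivity
  linarith

lemma Z_var (hχ : ∀ ω i, χ ω i * χ ω i = χ ω i)
    (hcnt : ∀ i j, ∑ ω, χ ω i * χ ω j = (Fintype.card Ω : ℝ) / c * (1 + if i = j then β else 0))
    (hc : 0 < c) (hab : α * (1 + β) = β) (hα : 0 ≤ α) (hβ : 0 ≤ β) (x : Fin p → ℝ) {ρ μ : ℝ}
    (hμ : 0 < μ) (hx : ∀ i, |x i| ≤ μ)
    (hρ : ∀ ω, ∑ k, χ ω k * x k ^ 2 ≤ ρ * ∑ k, x k ^ 2) (w : Fin p → ℝ) :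
    ∑ ω, (Zmat r c α x (χ ω) *ᵥ w) ⬝ᵥ (Zmat r c α x (χ ω) *ᵥ w) ≤
      (Fintype.card Ω : ℝ) * r ^ 2 * ((c * ρ - 1) * (∑ k, x k ^ 2) * (∑ k, x k * w k) ^ 2
        + c * β * ρ * (∑ k, x k ^ 2) * (∑ k, x k ^ 2 * w k ^ 2)
        + c * α * (μ ^ 2 / 4 * ((∑ k, x k ^ 2) * (∑ k, w k ^ 2)))) := by
  have a1 := cnt2 hcnt (fun i => x i * w i) (fun i => x i * w i)
  have a2 := cnt2 hcnt (fun i => x i * w i) (fun i => x i ^ 3 * w i)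
  have a3 := cnt1 hχ hcnt (fun i => x i ^ 4 * w i ^ 2)
  have a4 := cnt2 hcnt (fun i => x i ^ 2) (fun i => x i * w i)
  have a5 := cnt1 hχ hcnt (fun i => x i ^ 3 * w i)
  have hcr := cross_bound x w hμ hx
  set N : ℝ := (Fintype.card Ω : ℝ) with hN
  have hN0 : 0 ≤ N := by positivity
  have e : ∀ ω, (Zmat r c α x (χ ω) *ᵥ w) ⬝ᵥ (Zmat r c α x (χ ω) *ᵥ w) ≤
      (r ^ 2 * c ^ 2 * (ρ * ∑ k, x k ^ 2)) *
        ((∑ k, χ ω k * (x k * w k)) * (∑ k, χ ω k * (x k * w k)))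
      - (r ^ 2 * 2 * c ^ 2 * α) * ((∑ k, χ ω k * (x k * w k)) * (∑ k, χ ω k * (x k ^ 3 * w k)))
      + (r ^ 2 * c ^ 2 * α ^ 2) * (∑ k, χ ω k * (x k ^ 4 * w k ^ 2))
      - (r ^ 2 * 2 * (∑ k, x k * w k) * c) *
        ((∑ k, χ ω k * x k ^ 2) * (∑ k, χ ω k * (x k * w k)))
      + (r ^ 2 * 2 * (∑ k, x k * w k) * c * α) * (∑ k, χ ω k * (x k ^ 3 * w k))
      + r ^ 2 * ((∑ k, x k ^ 2) * (∑ k, x k * w k) ^ 2) := by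
    intro ω
    rw [Zmat_normsq r c α x (χ ω) w (hχ ω)]
    have := mul_le_mul_of_nonneg_left (hρ ω)
      (show 0 ≤ r ^ 2 * c ^ 2 * (∑ k, χ ω k * (x k * w k)) ^ 2 by positivity)
    linarith
  refine (Finset.sum_le_sum fun ω _ => e ω).trans ?_
  simp only [Finset.sum_sub_distrib, Finset.sum_add_distrib, ← Finset.mul_sum, a1, a2, a3, a4, a5]
  simp only [sum_const, card_univ, nsmul_eq_mul, ← hN]
  have e1 : ∑ i, x i * w i * (x i * w i) = ∑ i, x i ^ 2 * w i ^ 2 :=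
    Finset.sum_congr rfl fun i _ => by ring
  have e2 : ∑ i, x i * w i * (x i ^ 3 * w i) = ∑ i, x i ^ 4 * w i ^ 2 :=
    Finset.sum_congr rfl fun i _ => by ring
  have e3 : ∑ i, x i ^ 2 * (x i * w i) = ∑ i, x i ^ 3 * w i :=
    Finset.sum_congr rfl fun i _ => by ring
  rw [e1, e2, e3]
  set B := ∑ i, x i ^ 2
  set T := ∑ i, x i * w i
  set S3 := ∑ i, x i ^ 3 * w i
  set Q := ∑ i, x i ^ 4 * w i ^ 2
  set P := ∑ i, x i ^ 2 * w i ^ 2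
  have hQ : 0 ≤ Q := Finset.sum_nonneg fun k _ => by positivity
  have h1 := mul_le_mul_of_nonneg_left hcr (show 0 ≤ N * r ^ 2 * (c * α) by positivity)
  have h2 : 0 ≤ N * r ^ 2 * (c * α * β * Q) := by positivity
  refine le_trans (b := N * r ^ 2 * (c * ρ * B * (T ^ 2 + β * P) - 2 * c * α * (T * S3) - c * α * β * Q
    - B * T ^ 2)) (le_of_eq ?_) (by linarith)
  field_simp
  linear_combination (N * r ^ 2 * (2 * T * S3 + c * α * Q)) * hab

lemma Z_upper (hχ0 : ∀ ω i, χ ω i * χ ω i = χ ω i) (hc : 0 < c) (hα : 0 ≤ α) (hr : 0 ≤ r)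
    (x : Fin p → ℝ) {ρ M : ℝ} (hM : ∑ k, x k ^ 2 ≤ M) (hρ0 : 0 ≤ ρ)
    (hρ : ∀ ω, ∑ k, χ ω k * x k ^ 2 ≤ ρ * ∑ k, x k ^ 2) (ω : Ω) (w : Fin p → ℝ) :
    w ⬝ᵥ (Zmat r c α x (χ ω) *ᵥ w) ≤ r * (c * ρ * M) * (w ⬝ᵥ w) := by
  have hχn : ∀ i, 0 ≤ χ ω i := fun i => by rw [← hχ0]; exact mul_self_nonneg _
  rw [Zmat_quad, mul_assoc r]
  refine mul_le_mul_of_nonneg_left ?_ hr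
  have h1 : (∑ k, χ ω k * (x k * w k)) ^ 2 ≤ (∑ k, χ ω k * x k ^ 2) * (w ⬝ᵥ w) := by
    have := Finset.sum_mul_sq_le_sq_mul_sq Finset.univ (fun k => χ ω k * x k) w
    have e : ∑ k, (χ ω k * x k) ^ 2 = ∑ k, χ ω k * x k ^ 2 :=
      Finset.sum_congr rfl fun k _ => by rw [mul_pow, sq (χ ω k), hχ0]
    rw [e] at this
    simpa [mul_assoc, dotProduct, sq] using this
  have hw : 0 ≤ w ⬝ᵥ w := Finset.sum_nonneg fun k _ => mul_self_nonneg _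
  have h2 : 0 ≤ ∑ k, χ ω k * (x k ^ 2 * w k ^ 2) :=
    Finset.sum_nonneg fun k _ => mul_nonneg (hχn k) (by positivity)
  have h3 : (∑ k, χ ω k * x k ^ 2) ≤ ρ * M := (hρ ω).trans (mul_le_mul_of_nonneg_left hM hρ0)
  have h4 := h1.trans (mul_le_mul_of_nonneg_right h3 hw)
  have h5 := mul_le_mul_of_nonneg_left h4 hc.le
  have h6 : 0 ≤ c * α * ∑ k, χ ω k * (x k ^ 2 * w k ^ 2) := by positivity
  have h7 := sq_nonneg (∑ k, x k * w k)
  linarith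

lemma Z_lower (hχ0 : ∀ ω i, χ ω i * χ ω i = χ ω i) (hc : 0 < c) (hα : 0 ≤ α) (hr : 0 ≤ r)
    (x : Fin p → ℝ) {M μ : ℝ} (hM : ∑ k, x k ^ 2 ≤ M) (hx : ∀ i, |x i| ≤ μ)
    (ω : Ω) (w : Fin p → ℝ) :
    w ⬝ᵥ ((-Zmat r c α x (χ ω)) *ᵥ w) ≤ r * (M + c * α * μ ^ 2) * (w ⬝ᵥ w) := by
  have hχn : ∀ i, χ ω i ≤ 1 := fun i => by nlinarith [hχ0 ω i, sq_nonneg (χ ω i - 1)]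
  rw [neg_mulVec, dotProduct_neg, Zmat_quad, mul_assoc r, ← mul_neg]
  refine mul_le_mul_of_nonneg_left ?_ hr
  have h1 : (∑ k, x k * w k) ^ 2 ≤ M * (w ⬝ᵥ w) := by
    have := Finset.sum_mul_sq_le_sq_mul_sq Finset.univ x w
    refine this.trans ?_
    have e : ∑ k, w k ^ 2 = w ⬝ᵥ w := by simp [dotProduct, sq]
    rw [e]
    exact mul_le_mul_of_nonneg_right hM (Finset.sum_nonneg fun k _ => mul_self_nonneg _)
  have h2 : ∑ k, χ ω k * (x k ^ 2 * w k ^ 2) ≤ μ ^ 2 * (w ⬝ᵥ w) := by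
    rw [dotProduct, Finset.mul_sum]
    refine Finset.sum_le_sum fun k _ => ?_
    have a : x k ^ 2 ≤ μ ^ 2 := sq_le_sq.2 ((hx k).trans (le_abs_self _))
    have b : 0 ≤ x k ^ 2 * w k ^ 2 := by positivity
    nlinarith [mul_le_mul_of_nonneg_right (hχn k) b, mul_le_mul_of_nonneg_right a (sq_nonneg (w k))]
  have h3 := mul_le_mul_of_nonneg_left h2 (mul_nonneg hc.le hα)
  have h4 : 0 ≤ c * (∑ k, χ ω k * (x k * w k)) ^ 2 := by positivity
  linarith

end abs

lemma samp_mul {p m : ℕ} (σ : Fin m ↪ Fin p) :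
    sampMatrix σ * (sampMatrix σ)ᵀ = diagonal (chi σ) := by
  ext i j
  rw [mul_apply, diagonal_apply]
  simp only [sampMatrix, transpose_apply, of_apply]
  split_ifs with h
  · subst h
    rw [chi_eq_sum]
    exact Finset.sum_congr rfl fun k _ => by split_ifs <;> simp
  · apply Finset.sum_eq_zero
    intro k _
    by_cases h1 : σ k = i
    · rw [if_neg (fun h2 => h (h1.symm.trans h2)), mul_zero]
    · rw [if_neg h1, zero_mul]

lemma dev_eq {p n m : ℕ} (x : Fin n → Fin p → ℝ) (ω : Fin n → (Fin m ↪ Fin p)) :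
    covEst x ω - covEmp x = ∑ i, Zmat ((n : ℝ)⁻¹)
      (((p : ℝ) * ((p : ℝ) - 1)) / ((m : ℝ) * ((m : ℝ) - 1))) (((p : ℝ) - m) / ((p : ℝ) - 1))
      (x i) (chi (ω i)) := by
  have hH : ∀ a b, covHat x ω a b = (((p : ℝ) * ((p : ℝ) - 1)) / ((m : ℝ) * ((m : ℝ) - 1))) *
      ((n : ℝ)⁻¹ * ∑ i, chi (ω i) a * x i a * (chi (ω i) b * x i b)) := by
    intro a b
    simp only [covHat, samp_mul, Matrix.smul_apply, smul_eq_mul, Matrix.sum_apply, mul_diagonal,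
      diagonal_mul, vecMulVec_apply]
    congr 2
    exact Finset.sum_congr rfl fun k _ => by ring
  ext a b
  simp only [covEst, covEmp, diagPart, Matrix.sub_apply, Matrix.smul_apply, smul_eq_mul,
    diagonal_apply, diag_apply, Matrix.sum_apply, hH, Zmat, vecMulVec_apply]
  by_cases h : a = b
  · subst h
    simp only [if_true, mul_sub, Finset.sum_sub_distrib, ← Finset.mul_sum]
    have : ∑ i, chi (ω i) a * x i a * (chi (ω i) a * x i a) = ∑ i, chi (ω i) a * x i a ^ 2 :=
      Finset.sum_congr rfl fun i _ => by linear_combination (x i a ^ 2) * chi_sq (ω i) a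
    rw [this]; ring
  · simp only [if_neg h, mul_zero, sub_zero, mul_sub, Finset.sum_sub_distrib, ← Finset.mul_sum]
    ring

lemma quad_emp {p n : ℕ} (x : Fin n → Fin p → ℝ) (w : Fin p → ℝ) :
    w ⬝ᵥ (covEmp x *ᵥ w) = (n : ℝ)⁻¹ * ∑ i, (∑ k, x i k * w k) ^ 2 := by
  rw [covEmp, smul_mulVec, dotProduct_smul, smul_eq_mul, sum_mulVec, dotProduct_sum]
  congr 1
  refine Finset.sum_congr rfl fun i _ => ?_
  rw [vecMulVec_mulVec]
  simp [dotProduct, ← Finset.mul_sum, ← Finset.sum_mul, ← mul_assoc, sq, mul_comm]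

lemma quad_diag {p n : ℕ} (x : Fin n → Fin p → ℝ) (w : Fin p → ℝ) :
    w ⬝ᵥ (diagPart (covEmp x) *ᵥ w) = (n : ℝ)⁻¹ * ∑ i, ∑ k, x i k ^ 2 * w k ^ 2 := by
  rw [Finset.sum_comm, Finset.mul_sum, dotProduct]
  refine Finset.sum_congr rfl fun k _ => ?_
  simp only [diagPart, mulVec_diagonal, diag_apply, covEmp, Matrix.smul_apply, Matrix.sum_apply,
    vecMulVec_apply, smul_eq_mul, ← Finset.sum_mul]
  rw [show ∑ i, x i k * x i k = ∑ i, x i k ^ 2 from Finset.sum_congr rfl fun i _ => by ring]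
  ring

lemma specNorm_nonneg {p : ℕ} (A : Matrix (Fin p) (Fin p) ℝ) : 0 ≤ specNorm A := norm_nonneg _

lemma probOf_compl {Ω : Type*} [Fintype Ω] [Nonempty Ω] (A : Set Ω) (b : ℝ)
    (h : (Aᶜ.ncard : ℝ) ≤ Fintype.card Ω * b) : probOf A ≥ 1 - b := by
  have hN : (0 : ℝ) < Fintype.card Ω := by exact_mod_cast Fintype.card_pos
  have h1 : (A.ncard : ℝ) + Aᶜ.ncard = Fintype.card Ω := by
    rw [← Nat.card_eq_fintype_card]
    exact_mod_cast Set.ncard_add_ncard_compl A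
  rw [probOf, ge_iff_le, le_div_iff₀ hN]
  linarith

section main
variable {p n : ℕ} {Ω : Type*} [Fintype Ω] [Nonempty Ω] {χ : Ω → Fin p → ℝ} {c α β : ℝ}

/-- quadratic-form bound on the total variance -/
lemma V_bound (hn : 0 < n) (hχ : ∀ ω i, χ ω i * χ ω i = χ ω i)
    (hcnt : ∀ i j, ∑ ω, χ ω i * χ ω j = (Fintype.card Ω : ℝ) / c * (1 + if i = j then β else 0))
    (hc : 0 < c) (hab : α * (1 + β) = β) (hα : 0 ≤ α) (hβ : 0 ≤ β) (hαβ : α ≤ β)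
    (x : Fin n → Fin p → ℝ) {ρ μ M : ℝ} (hcρ : 1 ≤ c * ρ) (hρ0 : 0 ≤ ρ)
    (hμ : 0 < μ) (hx : ∀ i j, |x i j| ≤ μ) (hM : ∀ i, ∑ k, x i k ^ 2 ≤ M)
    (hρ : ∀ ω i, ∑ k, χ ω k * x i k ^ 2 ≤ ρ * ∑ k, x i k ^ 2)
    (w : Fin p → ℝ) :
    w ⬝ᵥ (((Fintype.card Ω : ℝ)⁻¹ • ∑ i, ∑ ω, Zmat ((n : ℝ)⁻¹) c α (x i) (χ ω) *
      Zmat ((n : ℝ)⁻¹) c α (x i) (χ ω)) *ᵥ w) ≤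
      (n : ℝ)⁻¹ * ((c * ρ - 1) * M * specNorm (covEmp x) +
        c * β * ρ * M * specNorm (diagPart (covEmp x)) +
        c * β * μ ^ 2 / 4 * ((∑ i, ∑ j, x i j ^ 2) / n)) * (w ⬝ᵥ w) := by
  have hN : (0 : ℝ) < Fintype.card Ω := by exact_mod_cast Fintype.card_pos
  have hn' : (0 : ℝ) < n := by exact_mod_cast hn
  set r : ℝ := (n : ℝ)⁻¹ with hr
  have hr0 : 0 < r := by positivity
  have e0 : ∀ i ω, w ⬝ᵥ ((Zmat r c α (x i) (χ ω) * Zmat r c α (x i) (χ ω)) *ᵥ w) =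
      (Zmat r c α (x i) (χ ω) *ᵥ w) ⬝ᵥ (Zmat r c α (x i) (χ ω) *ᵥ w) := by
    intro i ω
    have hT : (Zmat r c α (x i) (χ ω))ᵀ = Zmat r c α (x i) (χ ω) := by
      have := (Zmat_herm r c α (x i) (χ ω)).eq
      rwa [conjTranspose_eq_transpose_of_trivial] at this
    rw [← mulVec_mulVec, dotProduct_mulVec w, ← mulVec_transpose, hT]
  have e1 : ∀ i, ∑ ω, w ⬝ᵥ ((Zmat r c α (x i) (χ ω) * Zmat r c α (x i) (χ ω)) *ᵥ w) ≤
      (Fintype.card Ω : ℝ) * (r ^ 2 * ((c * ρ - 1) * M * (∑ k, x i k * w k) ^ 2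
        + c * β * ρ * M * (∑ k, x i k ^ 2 * w k ^ 2)
        + c * β * (μ ^ 2 / 4 * ((∑ k, x i k ^ 2) * (w ⬝ᵥ w))))) := by
    intro i
    simp only [e0]
    refine (Z_var hχ hcnt hc hab hα hβ (x i) hμ (hx i) (fun ω => hρ ω i) w).trans ?_
    rw [mul_assoc]
    have hw : ∑ k, w k ^ 2 = w ⬝ᵥ w := by simp [dotProduct, sq]
    have hw0 : 0 ≤ w ⬝ᵥ w := by rw [← hw]; exact Finset.sum_nonneg fun k _ => sq_nonneg _
    rw [hw]
    have hB : 0 ≤ ∑ k, x i k ^ 2 := Finset.sum_nonneg fun k _ => sq_nonneg _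
    have hP : 0 ≤ ∑ k, x i k ^ 2 * w k ^ 2 := Finset.sum_nonneg fun k _ => by positivity
    have h1 := hM i
    have h2 : 0 ≤ c * ρ - 1 := by linarith
    gcongr
  rw [smul_mulVec, dotProduct_smul, smul_eq_mul, sum_mulVec, dotProduct_sum]
  simp only [sum_mulVec, dotProduct_sum]
  rw [inv_mul_le_iff₀ hN]
  refine (Finset.sum_le_sum fun i _ => e1 i).trans ?_
  rw [← Finset.mul_sum]
  refine mul_le_mul_of_nonneg_left ?_ hN.le
  simp only [← Finset.mul_sum, Finset.sum_add_distrib, ← Finset.sum_mul]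
  have q1 := quad_le_specNorm_aux (covEmp x) w
  have q2 := quad_le_specNorm_aux (diagPart (covEmp x)) w
  rw [quad_emp] at q1
  rw [quad_diag] at q2
  change _ ≤ specNorm (covEmp x) * _ at q1
  change _ ≤ specNorm (diagPart (covEmp x)) * _ at q2
  rw [← hr] at q1 q2
  have hM0 : 0 ≤ M := le_trans (Finset.sum_nonneg fun k _ => sq_nonneg _) (hM ⟨0, hn⟩)
  have g1 := mul_le_mul_of_nonneg_left q1
    (mul_nonneg hr0.le (mul_nonneg (sub_nonneg.2 hcρ) hM0))
  have g2 := mul_le_mul_of_nonneg_left q2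
    (mul_nonneg hr0.le (show 0 ≤ c * β * ρ * M by positivity))
  rw [div_eq_mul_inv _ (n : ℝ), ← hr]
  nlinarith [g1, g2]

lemma tr_bound (hn : 0 < n) (hχ : ∀ ω i, χ ω i * χ ω i = χ ω i)
    (hcnt : ∀ i j, ∑ ω, χ ω i * χ ω j = (Fintype.card Ω : ℝ) / c * (1 + if i = j then β else 0))
    (hc : 1 ≤ c) (hab : α * (1 + β) = β) (hβ : 0 ≤ β) (hα1 : α ≤ 1)
    (x : Fin n → Fin p → ℝ) {M : ℝ} (hM : ∀ i, ∑ k, x i k ^ 2 ≤ M) :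
    trace ((Fintype.card Ω : ℝ)⁻¹ • ∑ i, ∑ ω, Zmat ((n : ℝ)⁻¹) c α (x i) (χ ω) *
      Zmat ((n : ℝ)⁻¹) c α (x i) (χ ω)) ≤
      (n : ℝ)⁻¹ * ((c - 1) * M * ((∑ i, ∑ j, x i j ^ 2) / n)) := by
  have hN : (0 : ℝ) < Fintype.card Ω := by exact_mod_cast Fintype.card_pos
  rw [trace_smul, smul_eq_mul, inv_mul_le_iff₀ hN]
  simp only [trace_sum]
  have e : ∀ i, ∑ ω, trace (Zmat ((n : ℝ)⁻¹) c α (x i) (χ ω) *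
      Zmat ((n : ℝ)⁻¹) c α (x i) (χ ω)) ≤
      (Fintype.card Ω : ℝ) * ((n : ℝ)⁻¹ ^ 2 * ((c - 1) * M)) * (∑ k, x i k ^ 2) := by
    intro i
    refine (Z_trace hχ hcnt (by linarith) hab hβ hα1 (x i)).trans ?_
    have hB : 0 ≤ ∑ k, x i k ^ 2 := Finset.sum_nonneg fun k _ => sq_nonneg _
    have h1 := mul_le_mul_of_nonneg_right (hM i) hB
    have h2 : 0 ≤ (Fintype.card Ω : ℝ) * (n : ℝ)⁻¹ ^ 2 * (c - 1) :=
      mul_nonneg (by positivity) (by linarith)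
    have := mul_le_mul_of_nonneg_left h1 h2
    nlinarith
  refine (Finset.sum_le_sum fun i _ => e i).trans (le_of_eq ?_)
  rw [← Finset.mul_sum]
  ring

end main

lemma chi_one {p : ℕ} (σ : Fin p ↪ Fin p) (i : Fin p) : chi σ i = 1 := by
  have hs : Function.Surjective σ := Finite.surjective_of_injective σ.injective
  unfold chi
  rw [if_pos]
  exact hs i

lemma not_le_specNorm {p : ℕ} {S : Matrix (Fin p) (Fin p) ℝ} (h : S.IsHermitian) {t : ℝ}
    (ht : 0 ≤ t) (hS : ¬ specNorm S ≤ t) :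
    (∃ w, t * (w ⬝ᵥ w) < w ⬝ᵥ (S *ᵥ w)) ∨ (∃ w, t * (w ⬝ᵥ w) < w ⬝ᵥ ((-S) *ᵥ w)) := by
  by_contra hcon
  push Not at hcon
  apply hS
  refine specNorm_ge_aux h ht fun w => abs_le.2 ⟨?_, hcon.1 w⟩
  have := hcon.2 w
  rw [neg_mulVec, dotProduct_neg] at this
  linarith

lemma main_case (p n m : ℕ) (hn : 0 < n) (hm : 2 ≤ m) (hmp : m < p)
    (x : Fin n → Fin p → ℝ) (ρ : ℝ) (hρ : 0 < ρ)
    (hρb : ∀ (σ : Fin m ↪ Fin p) (i : Fin n), ∑ k, chi σ k * x i k ^ 2 ≤ ρ * ∑ k, x i k ^ 2)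
    (hx0 : ∃ i j, x i j ≠ 0) (t : ℝ) (ht : 0 ≤ t) :
    probOf {ω : Fin n → (Fin m ↪ Fin p) | specNorm (covEst x ω - covEmp x) ≤ t} ≥
      1 - p * Real.exp (-(t ^ 2 / 2) / (bernVar p n m x ρ + bernL p n m x ρ * t / 3)) := by
  have hm' : (2 : ℝ) ≤ m := by exact_mod_cast hm
  have hp' : (m : ℝ) + 1 ≤ p := by exact_mod_cast hmp
  have hn' : (0 : ℝ) < n := by exact_mod_cast hn
  have hm1 : (0 : ℝ) < (m : ℝ) - 1 := by linarith
  have hp1 : (0 : ℝ) < (p : ℝ) - 1 := by linarith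
  have hm0 : (0 : ℝ) < (m : ℝ) := by linarith
  have hp0 : (0 : ℝ) < (p : ℝ) := by linarith
  have hpm : (0 : ℝ) < (p : ℝ) - m := by linarith
  haveI : Nonempty (Fin m ↪ Fin p) := ⟨(Fin.castLEEmb hmp.le)⟩
  have hcnt := fun i j => chi_count hm hmp.le i j
  set c : ℝ := ((p : ℝ) * ((p : ℝ) - 1)) / ((m : ℝ) * ((m : ℝ) - 1)) with hc
  set α : ℝ := ((p : ℝ) - m) / ((p : ℝ) - 1) with hα
  set β : ℝ := ((p : ℝ) - m) / ((m : ℝ) - 1) with hβ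
  have hc1 : 1 ≤ c := by
    rw [hc, one_le_div (by positivity)]
    nlinarith
  have hc0 : 0 < c := by linarith
  have hα0 : 0 ≤ α := by positivity
  have hβ0 : 0 < β := by positivity
  have hα1 : α ≤ 1 := by rw [hα, div_le_one hp1]; linarith
  have hab : α * (1 + β) = β := by rw [hα, hβ]; field_simp; ring
  have hαβ : α ≤ β := by
    rw [← hab]; nlinarith
  -- suprema
  set M : ℝ := ⨆ i, ∑ j, x i j ^ 2 with hMdef
  set μ : ℝ := ⨆ j, ⨆ i, |x i j| with hμdef
  have hM : ∀ i, ∑ k, x i k ^ 2 ≤ M := fun i =>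
    le_ciSup (f := fun i => ∑ j, x i j ^ 2) (Set.finite_range _).bddAbove i
  have hxμ : ∀ i j, |x i j| ≤ μ := fun i j =>
    (le_ciSup (f := fun i => |x i j|) (Set.finite_range _).bddAbove i).trans
      (le_ciSup (f := fun j => ⨆ i, |x i j|) (Set.finite_range _).bddAbove j)
  obtain ⟨i0, j0, hij0⟩ := hx0
  have hμ0 : 0 < μ := lt_of_lt_of_le (abs_pos.2 hij0) (hxμ i0 j0)
  have hB0 : 0 < ∑ k, x i0 k ^ 2 :=
    lt_of_lt_of_le (by positivity : 0 < x i0 j0 ^ 2)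
      (Finset.single_le_sum (f := fun k => x i0 k ^ 2) (fun k _ => sq_nonneg _)
        (Finset.mem_univ j0))
  have hM0 : 0 < M := lt_of_lt_of_le hB0 (hM i0)
  have hMμ : M ≤ p * μ ^ 2 := by
    haveI : Nonempty (Fin n) := ⟨i0⟩
    refine ciSup_le fun i => ?_
    refine (Finset.sum_le_sum (g := fun _ => μ ^ 2) fun j _ => ?_).trans (le_of_eq (by simp))
    exact sq_le_sq.2 ((hxμ i j).trans (le_abs_self _))
  set F : ℝ := ∑ i, ∑ j, x i j ^ 2 with hF
  have hF0 : 0 < F := lt_of_lt_of_le hB0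
    (Finset.single_le_sum (f := fun i => ∑ k, x i k ^ 2)
      (fun i _ => Finset.sum_nonneg fun k _ => sq_nonneg _) (Finset.mem_univ i0))
  have hcρ : 1 ≤ c * ρ := by
    have h1 := cnt1 chi_sq hcnt (fun k => x i0 k ^ 2)
    have h2 := Finset.sum_le_sum fun σ (_ : σ ∈ (Finset.univ : Finset (Fin m ↪ Fin p))) => hρb σ i0
    have hN : (0 : ℝ) < Fintype.card (Fin m ↪ Fin p) := by exact_mod_cast Fintype.card_pos
    rw [h1] at h2
    simp only [sum_const, card_univ, nsmul_eq_mul] at h2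
    rw [← mul_assoc] at h2
    have h3 := le_of_mul_le_mul_right h2 hB0
    rw [div_mul_eq_mul_div, div_le_iff₀ hc0, mul_assoc] at h3
    have h4 := le_of_mul_le_mul_left h3 hN
    linarith
  -- the pieces of the variance
  set Q : ℝ := ⨆ j, ∑ i, x i j ^ 4 with hQ
  have hQ0 : 0 ≤ Q := Real.iSup_nonneg fun j => Finset.sum_nonneg fun i _ => by positivity
  set s : ℝ := (n : ℝ)⁻¹ * (2 * c * β * μ ^ 2 * (F / n)) with hs
  have hs0 : 0 < s := by positivity
  set v : ℝ := bernVar p n m x ρ - s / 2 with hv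
  set T : ℝ := (n : ℝ)⁻¹ * ((c * ρ - 1) * M * specNorm (covEmp x) +
        c * β * ρ * M * specNorm (diagPart (covEmp x))) with hT
  have hT0 : 0 ≤ T := by
    have h1 := specNorm_nonneg (covEmp x)
    have h2 := specNorm_nonneg (diagPart (covEmp x))
    have h3 : 0 ≤ c * ρ - 1 := by linarith
    positivity
  have hvT : T + s / 2 ≤ v := by
    have e1 : ((p : ℝ) * ((p : ℝ) - 1) * ((p : ℝ) - m)) / ((m : ℝ) * ((m : ℝ) - 1) ^ 2) = c * β := by
      rw [hc, hβ]; field_simp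
    have e2 : (2 * (p : ℝ) * ((p : ℝ) - 1) * ((p : ℝ) - m)) / ((m : ℝ) * ((m : ℝ) - 1) ^ 2) =
        2 * c * β := by
      rw [hc, hβ]; field_simp
    have h4 : 0 ≤ (n : ℝ)⁻¹ * ((((p : ℝ) * ((p : ℝ) - m) ^ 2) / ((m : ℝ) * ((m : ℝ) - 1) ^ 2)) *
        (Q / n)) := by positivity
    rw [hv, bernVar, e1, e2, hT, hs]
    linarith
  have hvs : s / 2 ≤ v := by linarith
  have hv0 : 0 < v := by linarith
  set Lp : ℝ := (n : ℝ)⁻¹ * (c * ρ * M) with hLp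
  set Lm : ℝ := (n : ℝ)⁻¹ * (M + c * α * μ ^ 2) with hLm
  have hLp0 : 0 ≤ Lp := by positivity
  have hLm0 : 0 ≤ Lm := by positivity
  have hLeq : bernL p n m x ρ = Lp + Lm := by
    have e1 : ((p : ℝ) * ((p : ℝ) - m)) / ((m : ℝ) * ((m : ℝ) - 1)) = c * α := by
      rw [hc, hα]; field_simp
    rw [bernL, e1, hLp, hLm]
    ring
  have hVeq : bernVar p n m x ρ = v + s / 2 := by rw [hv]; ring
  rw [hLeq, hVeq]
  set u : ℝ := t ^ 2 / 2 / (v + s / 2 + (Lp + Lm) * t / 3) with hu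
  rw [neg_div, ← hu]
  have hprob0 : 0 ≤ probOf {ω : Fin n → (Fin m ↪ Fin p) | specNorm (covEst x ω - covEmp x) ≤ t} := by
    unfold probOf; positivity
  rcases le_or_gt u (Real.log p) with hul | hul
  · refine le_trans ?_ hprob0
    have : Real.exp (-Real.log p) ≤ Real.exp (-u) := Real.exp_le_exp.2 (by linarith)
    rw [Real.exp_neg, Real.exp_log hp0] at this
    have h2 := mul_le_mul_of_nonneg_left this hp0.le
    rw [mul_inv_cancel₀ hp0.ne'] at h2
    linarith
  have ht0 : 0 < t := by
    rcases ht.eq_or_lt with h | h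
    · exfalso
      have : u = 0 := by rw [hu, ← h]; simp
      have h3 : 0 ≤ Real.log p := Real.log_nonneg (by linarith)
      linarith
    · exact h
  set Z : Fin n → (Fin m ↪ Fin p) → Matrix (Fin p) (Fin p) ℝ :=
    fun i σ => Zmat ((n : ℝ)⁻¹) c α (x i) (chi σ) with hZ
  set V : Matrix (Fin p) (Fin p) ℝ :=
    (Fintype.card (Fin m ↪ Fin p) : ℝ)⁻¹ • ∑ i, ∑ σ, Z i σ * Z i σ with hV
  have hZh : ∀ i σ, (Z i σ).IsHermitian := fun i σ => Zmat_herm _ _ _ _ _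
  have hmean : ∀ i, ∑ σ, Z i σ = 0 := fun i => Z_mean chi_sq hcnt hc0 hab (x i)
  have hVq : ∀ w, w ⬝ᵥ (V *ᵥ w) ≤ v * (w ⬝ᵥ w) := by
    intro w
    refine (V_bound hn chi_sq hcnt hc0 hab hα0 hβ0.le hαβ x hcρ hρ.le hμ0 hxμ hM hρb w).trans ?_
    refine mul_le_mul_of_nonneg_right ?_ (Finset.sum_nonneg fun k _ => mul_self_nonneg _)
    have : (n : ℝ)⁻¹ * ((c * ρ - 1) * M * specNorm (covEmp x) +
        c * β * ρ * M * specNorm (diagPart (covEmp x)) +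
        c * β * μ ^ 2 / 4 * (F / n)) = T + s / 8 := by
      rw [hT, hs]; ring
    rw [this]; linarith
  have htr : trace V ≤ (p - 2) * s := by
    refine (tr_bound hn chi_sq hcnt hc1 hab hβ0.le hα1 x hM).trans ?_
    have h1 : (c - 1) * p ≤ (p - 2) * (2 * c * β) := by
      rw [hc, hβ]
      have e1 : ((p : ℝ) * ((p : ℝ) - 1) / (m * ((m : ℝ) - 1)) - 1) * p =
          (((p : ℝ) - m) * (p + m - 1) * p * (m - 1)) / (m * ((m : ℝ) - 1) ^ 2) := by
        field_simp; ring
      have e2 : ((p : ℝ) - 2) * (2 * (p * (p - 1) / (m * (m - 1))) * ((p - m) / (m - 1))) =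
          (((p : ℝ) - m) * p * (2 * ((p - 1) * (p - 2)))) / (m * ((m : ℝ) - 1) ^ 2) := by
        field_simp
      rw [e1, e2]
      refine div_le_div_of_nonneg_right ?_ (by positivity)
      have h2 : ((p : ℝ) + m - 1) * (m - 1) ≤ 2 * ((p - 1) * (p - 2)) := by
        have := mul_le_mul (show (p : ℝ) + m - 1 ≤ 2 * (p - 1) by linarith)
          (show (m : ℝ) - 1 ≤ p - 2 by linarith) hm1.le (by linarith)
        linarith
      have := mul_le_mul_of_nonneg_left h2 (show 0 ≤ ((p : ℝ) - m) * p by positivity)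
      linarith
    have h2 : (c - 1) * M ≤ (p - 2) * (2 * c * β) * μ ^ 2 := by
      refine (mul_le_mul_of_nonneg_left hMμ (by linarith)).trans ?_
      rw [← mul_assoc]
      exact mul_le_mul_of_nonneg_right h1 (sq_nonneg _)
    have h3 := mul_le_mul_of_nonneg_left (mul_le_mul_of_nonneg_right h2
      (show 0 ≤ F / n by positivity)) (show 0 ≤ (n : ℝ)⁻¹ by positivity)
    refine h3.trans (le_of_eq ?_)
    rw [hs]; ring
  have hVH : ∀ w, w ⬝ᵥ (V *ᵥ w) ≥ 0 := by
    intro w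
    rw [hV, smul_mulVec, dotProduct_smul, smul_eq_mul, sum_mulVec, dotProduct_sum]
    refine mul_nonneg (by positivity) (Finset.sum_nonneg fun i _ => ?_)
    rw [sum_mulVec, dotProduct_sum]
    refine Finset.sum_nonneg fun ω _ => ?_
    have hTr : (Z i ω)ᵀ = Z i ω := by
      have := (hZh i ω).eq
      rwa [conjTranspose_eq_transpose_of_trivial] at this
    rw [← mulVec_mulVec, dotProduct_mulVec w, ← mulVec_transpose, hTr]
    exact Finset.sum_nonneg fun j _ => mul_self_nonneg _
  have hdiag : ∀ j, V j j = Pi.single j 1 ⬝ᵥ (V *ᵥ Pi.single j 1) := fun j => by simp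
  have hone : ∀ j : Fin p, (Pi.single j 1 : Fin p → ℝ) ⬝ᵥ Pi.single j 1 = 1 := fun j => by simp
  have htr0 : 0 ≤ trace V := Finset.sum_nonneg fun j _ => by
    rw [diag_apply, hdiag]; exact hVH _
  have htrp : trace V ≤ p * v := by
    refine (Finset.sum_le_sum (g := fun _ => v) fun j _ => ?_).trans (le_of_eq (by simp))
    rw [diag_apply, hdiag]
    have := hVq (Pi.single j 1)
    rwa [hone, mul_one] at this
  have hfin := final_scalar (p := p) (by omega) (d := trace V / v) hs0 hvs hLp0 hLm0 ht0
    (by positivity) (by rw [div_mul_cancel₀ _ hv0.ne']; exact htr)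
    (by rw [div_le_iff₀ hv0]; exact htrp) hu hul.le rfl rfl
  have b1 := bern_one Z hZh hmean hLp0 hv0 ht0
    (fun i σ w => Z_upper chi_sq hc0 hα0 (by positivity) (x i) (hM i) hρ.le (fun σ => hρb σ i) σ w)
    V hV hVq _ rfl
  have b2 := bern_one (fun i σ => -Z i σ) (fun i σ => (hZh i σ).neg)
    (fun i => by rw [Finset.sum_neg_distrib, hmean, neg_zero]) hLm0 hv0 ht0
    (fun i σ w => Z_lower chi_sq hc0 hα0 (by positivity) (x i) (hM i) (hxμ i) σ w)
    V (by simp only [neg_mul_neg]; exact hV) hVq _ rfl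
  rw [Fintype.card_fin] at b1 b2
  apply probOf_compl
  have hcard : (Fintype.card (Fin n → (Fin m ↪ Fin p)) : ℝ) =
      (Fintype.card (Fin m ↪ Fin p) : ℝ) ^ n := by
    rw [Fintype.card_fun, Fintype.card_fin]; push_cast; rfl
  rw [hcard]
  classical
  refine le_trans ?_ (mul_le_mul_of_nonneg_left hfin (by positivity))
  rw [mul_add]
  refine le_trans ?_ (add_le_add b1 b2)
  norm_cast
  refine le_trans ?_ (Finset.card_union_le _ _)
  rw [← Set.ncard_coe_finset]
  refine Set.ncard_le_ncard ?_ (Finset.finite_toSet _)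
  intro ω hω
  have hω' : ¬ specNorm (covEst x ω - covEmp x) ≤ t := hω
  rw [dev_eq] at hω'
  have hH : (∑ i, Z i (ω i)).IsHermitian := by
    unfold Matrix.IsHermitian
    rw [conjTranspose_sum]
    exact Finset.sum_congr rfl fun k _ => hZh k _
  rcases not_le_specNorm hH ht hω' with h | h
  · simp only [Finset.coe_union, Finset.coe_filter, Finset.mem_univ, true_and]
    exact Or.inl h
  · simp only [Finset.coe_union, Finset.coe_filter, Finset.mem_univ, true_and]
    refine Or.inr ?_
    obtain ⟨w, hw⟩ := h
    refine ⟨w, ?_⟩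
    rw [Finset.sum_neg_distrib]; exact hw

/-- concentration of the covariance estimator in spectral norm:
`P(‖Ĉ_n − C_emp‖₂ ≤ t) ≥ 1 − p·exp(−(t²/2)/(σ̄² + L t/3))`. -/
theorem stmt_8 (p n m : ℕ) (hp : 0 < p) (hn : 0 < n) (hm : 2 ≤ m) (hmp : m ≤ p)
    (x : Fin n → Fin p → ℝ) (ρ : ℝ) (hρ : 0 < ρ)
    (hρbound : ∀ (σ : Fin m ↪ Fin p) (i : Fin n),
      ∑ j, (((sampMatrix σ * (sampMatrix σ)ᵀ) *ᵥ x i) j) ^ 2 ≤ ρ * ∑ j, x i j ^ 2)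
    (t : ℝ) (ht : 0 ≤ t) :
    probOf {ω : Fin n → (Fin m ↪ Fin p) | specNorm (covEst x ω - covEmp x) ≤ t} ≥
      1 - p * Real.exp (-(t ^ 2 / 2) / (bernVar p n m x ρ + bernL p n m x ρ * t / 3)) := by
  haveI : Nonempty (Fin m ↪ Fin p) := ⟨(Fin.castLEEmb hmp)⟩
  have htriv : (∀ ω : Fin n → (Fin m ↪ Fin p), covEst x ω - covEmp x = 0) →
      probOf {ω : Fin n → (Fin m ↪ Fin p) | specNorm (covEst x ω - covEmp x) ≤ t} ≥
      1 - p * Real.exp (-(t ^ 2 / 2) / (bernVar p n m x ρ + bernL p n m x ρ * t / 3)) := by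
    intro h
    apply probOf_compl
    have : {ω : Fin n → (Fin m ↪ Fin p) | specNorm (covEst x ω - covEmp x) ≤ t}ᶜ = ∅ := by
      rw [Set.compl_empty_iff, Set.eq_univ_iff_forall]
      intro ω
      rw [Set.mem_setOf_eq, h, specNorm]
      simpa using ht
    rw [this]
    simp only [Set.ncard_empty, Nat.cast_zero]
    positivity
  rcases hmp.lt_or_eq with hlt | heq
  · by_cases hx : ∃ i j, x i j ≠ 0
    · refine main_case p n m hn hm hlt x ρ hρ (fun σ i => ?_) hx t ht
      refine le_trans (le_of_eq ?_) (hρbound σ i)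
      refine Finset.sum_congr rfl fun k _ => ?_
      rw [samp_mul, mulVec_diagonal, mul_pow, sq (chi σ k), chi_sq]
    · push Not at hx
      have hx' : ∀ i, x i = 0 := fun i => funext fun j => hx i j
      apply htriv
      intro ω
      rw [dev_eq]
      refine Finset.sum_eq_zero fun i _ => ?_
      ext a b
      simp [Zmat, hx', vecMulVec_apply, diagonal_apply]
  · subst heq
    apply htriv
    intro ω
    rw [dev_eq]
    refine Finset.sum_eq_zero fun i _ => ?_
    have hm' : (2 : ℝ) ≤ m := by exact_mod_cast hm
    have hc : ((m : ℝ) * ((m : ℝ) - 1)) / ((m : ℝ) * ((m : ℝ) - 1)) = 1 :=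
      div_self (mul_ne_zero (by linarith) (by linarith))
    rw [hc]
    ext a b
    simp [Zmat, chi_one, vecMulVec_apply, diagonal_apply]
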